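/- arXiv:1310.2897 — 7 statements merged into one kernel-verified Lean document; each statement's English description precedes it below -/
import Mathlib

section
/- Let M be the quotient of (Fin 6 → ZMod 2) by the span of the constant function 1, N the quotient of (Fin 3 → ZMod 2) by the span of the constant function 1, and V = M ⊗[ZMod 2] N, with the action of Perm (Fin 6) × Perm (Fin 3) induced by permuting coordinates. Then the number of orbits of this action on the set of nonzero vectors of V is exactly 8. -/
open TensorProduct

/-- The span of the constant function `1` in `Fin n → ZMod 2`. -/
def constSpan (n : ℕ) : Submodule (ZMod 2) (Fin n → ZMod 2) :=
  Submodule.span (ZMod 2) {fun _ => 1}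

/-- `M`, the quotient of `Fin 6 → ZMod 2` by the span of the constant function `1`. -/
abbrev Mspace := (Fin 6 → ZMod 2) ⧸ constSpan 6

/-- `N`, the quotient of `Fin 3 → ZMod 2` by the span of the constant function `1`. -/
abbrev Nspace := (Fin 3 → ZMod 2) ⧸ constSpan 3

/-- The linear automorphism of `Fin n → ZMod 2` given by permuting coordinates:
`(σ • f) i = f (σ⁻¹ i)`. -/
def permFun {n : ℕ} (σ : Equiv.Perm (Fin n)) :
    (Fin n → ZMod 2) ≃ₗ[ZMod 2] (Fin n → ZMod 2) :=
  LinearEquiv.funCongrLeft (ZMod 2) (ZMod 2) σ.symm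

lemma constSpan_map {n : ℕ} (σ : Equiv.Perm (Fin n)) :
    (constSpan n).map (permFun σ : (Fin n → ZMod 2) →ₗ[ZMod 2] (Fin n → ZMod 2))
      = constSpan n := by
  have h : (permFun σ) (fun _ => 1) = (fun _ => (1 : ZMod 2)) := rfl
  simp [constSpan, Submodule.map_span, Set.image_singleton, h]

/-- The induced linear automorphism of the quotient `(Fin n → ZMod 2) ⧸ constSpan n`. -/
def quotPerm {n : ℕ} (σ : Equiv.Perm (Fin n)) :
    ((Fin n → ZMod 2) ⧸ constSpan n) ≃ₗ[ZMod 2] ((Fin n → ZMod 2) ⧸ constSpan n) :=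
  Submodule.Quotient.equiv _ _ (permFun σ) (constSpan_map σ)

/-- The Veldkamp space `V = M ⊗ N`. -/
abbrev Vspace := Mspace ⊗[ZMod 2] Nspace

/-- The linear action of `Perm (Fin 6) × Perm (Fin 3)` on `V = M ⊗ N` induced by
permuting coordinates in the two factors. -/
noncomputable def Gact (g : Equiv.Perm (Fin 6) × Equiv.Perm (Fin 3)) : Vspace ≃ₗ[ZMod 2] Vspace :=
  TensorProduct.congr (quotPerm g.1) (quotPerm g.2)


/-- Class of a coordinate function. -/
def cls {n : ℕ} (f : Fin n → ZMod 2) : (Fin n → ZMod 2) ⧸ constSpan n :=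
  Submodule.Quotient.mk f

lemma mem_constSpan {n : ℕ} (f : Fin n → ZMod 2) :
    f ∈ constSpan n ↔ ∃ c : ZMod 2, ∀ i, f i = c := by
  unfold constSpan
  rw [Submodule.mem_span_singleton]
  constructor
  · rintro ⟨c, rfl⟩
    exact ⟨c, fun i => by simp⟩
  · rintro ⟨c, h⟩
    exact ⟨c, by ext i; simp [h i]⟩

lemma cls_eq {n : ℕ} (f g : Fin n → ZMod 2) :
    cls f = cls g ↔ ∃ c : ZMod 2, ∀ i, f i - g i = c := by
  unfold cls
  rw [Submodule.Quotient.eq, mem_constSpan]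
  rfl

lemma quotPerm_cls {n : ℕ} (σ : Equiv.Perm (Fin n)) (f : Fin n → ZMod 2) :
    quotPerm σ (cls f) = cls (fun i => f (σ.symm i)) := rfl

lemma cls_add {n : ℕ} (f g : Fin n → ZMod 2) : cls f + cls g = cls (f + g) := rfl

lemma cls_surj {n : ℕ} (x : (Fin n → ZMod 2) ⧸ constSpan n) : ∃ f, cls f = x :=
  Submodule.Quotient.mk_surjective _ x

/-- Representatives of the four elements of `N`. -/
def nrep (x : Fin 4) : Fin 3 → ZMod 2 := fun j => if x = j.succ then 1 else 0

/-- The four elements of `N`. -/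
def nn (x : Fin 4) : Nspace := cls (nrep x)

lemma nn_inj (x y : Fin 4) (h : nn x = nn y) : x = y := by
  unfold nn at h
  rw [cls_eq] at h
  revert x y
  decide

lemma nn_surj (z : Nspace) : ∃ x, nn x = z := by
  obtain ⟨f, rfl⟩ := cls_surj z
  unfold nn
  simp only [cls_eq]
  revert f
  decide

lemma nn_perm (p : Equiv.Perm (Fin 4)) :
    ∃ (t : Equiv.Perm (Fin 3)) (c : Fin 4), ∀ x, nn (p x) = quotPerm t (nn x) + nn c := by
  simp only [nn, quotPerm_cls, cls_add, cls_eq]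
  revert p
  decide +kernel

/-- The class in `M` of a basis vector. -/
def mm (i : Fin 6) : Mspace := cls (Pi.single i 1)

lemma quotPerm_mm (s : Equiv.Perm (Fin 6)) (i : Fin 6) : quotPerm s (mm i) = mm (s i) := by
  unfold mm
  rw [quotPerm_cls]
  congr 1
  ext j
  simp [Pi.single_apply, Equiv.symm_apply_eq]

lemma sum_mm : ∑ i, mm i = 0 := by
  have : ∑ i, mm i = cls (∑ i, Pi.single i 1) := by
    simp only [Fin.sum_univ_succ, Fin.sum_univ_zero, mm]
    rfl
  rw [this]
  change _ = cls 0
  rw [cls_eq]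
  decide

lemma cls_eq_sum (f : Fin 6 → ZMod 2) : cls f = ∑ i, f i • mm i := by
  have h : f = ∑ i, f i • (Pi.single i 1 : Fin 6 → ZMod 2) := by
    ext j
    simp [Finset.sum_apply, Pi.single_apply]
  change (constSpan 6).mkQ f = ∑ i, f i • (constSpan 6).mkQ (Pi.single i 1)
  conv_lhs => rw [h]
  simp only [map_sum, map_smul]

/-- The vector of `V` attached to a colouring of six points by four colours. -/
noncomputable def FF (f : Fin 6 → Fin 4) : Vspace := ∑ i, mm i ⊗ₜ[ZMod 2] nn (f i)

lemma FF_surj (v : Vspace) : ∃ f, FF f = v := by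
  suffices h : ∃ z : Fin 6 → Nspace, ∑ i, mm i ⊗ₜ[ZMod 2] z i = v by
    obtain ⟨z, rfl⟩ := h
    choose f hf using fun i => nn_surj (z i)
    exact ⟨f, by simp only [FF, hf]⟩
  induction v using TensorProduct.induction_on with
  | zero => exact ⟨0, by simp⟩
  | tmul m n =>
    obtain ⟨f, rfl⟩ := cls_surj m
    refine ⟨fun i => f i • n, ?_⟩
    rw [cls_eq_sum, TensorProduct.sum_tmul]
    simp only [TensorProduct.tmul_smul, TensorProduct.smul_tmul']
  | add a b ha hb =>
    obtain ⟨x, rfl⟩ := ha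
    obtain ⟨y, rfl⟩ := hb
    exact ⟨x + y, by simp [TensorProduct.tmul_add, Finset.sum_add_distrib]⟩

lemma FF_const (c : Fin 4) : FF (fun _ => c) = 0 := by
  unfold FF
  rw [← TensorProduct.sum_tmul, sum_mm, TensorProduct.zero_tmul]

lemma Gact_FF (s : Equiv.Perm (Fin 6)) (p : Equiv.Perm (Fin 4)) (f : Fin 6 → Fin 4) :
    ∃ t, Gact (s, t) (FF f) = FF (fun i => p (f (s.symm i))) := by
  obtain ⟨t, c, h⟩ := nn_perm p
  refine ⟨t, ?_⟩
  have h1 : Gact (s, t) (FF f) = ∑ i, mm (s i) ⊗ₜ[ZMod 2] quotPerm t (nn (f i)) := by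
    simp only [FF, map_sum, Gact, TensorProduct.congr_tmul, quotPerm_mm]
  have h2 := FF_const c
  unfold FF at h2
  rw [h1]
  simp only [FF, h, TensorProduct.tmul_add, Finset.sum_add_distrib, h2, add_zero]
  refine Eq.trans ?_ (Equiv.sum_comp s
    (fun i => mm i ⊗ₜ[ZMod 2] quotPerm t (nn (f (s.symm i)))))
  simp only [Equiv.symm_apply_apply]

/-- Difference of two coordinates, on `M`. -/
def psi (i j : Fin 6) : Mspace →ₗ[ZMod 2] ZMod 2 :=
  (constSpan 6).liftQ ((LinearMap.proj i : (Fin 6 → ZMod 2) →ₗ[ZMod 2] ZMod 2) - LinearMap.proj j) (by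
    intro f hf
    obtain ⟨c, h⟩ := (mem_constSpan f).1 hf
    change f i - f j = 0
    rw [h, h, sub_self])

lemma psi_cls (i j : Fin 6) (f : Fin 6 → ZMod 2) : psi i j (cls f) = f i - f j := rfl

/-- Difference of two coordinates, on `V`. -/
noncomputable def phi (i j : Fin 6) : Vspace →ₗ[ZMod 2] Nspace :=
  (TensorProduct.lid (ZMod 2) Nspace).toLinearMap ∘ₗ (psi i j).rTensor Nspace

lemma phi_tmul (i j : Fin 6) (m : Mspace) (n : Nspace) :
    phi i j (m ⊗ₜ[ZMod 2] n) = psi i j m • n := by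
  simp [phi]

lemma phi_Gact (g : Equiv.Perm (Fin 6) × Equiv.Perm (Fin 3)) (i j : Fin 6) (v : Vspace) :
    phi i j (Gact g v) = quotPerm g.2 (phi (g.1.symm i) (g.1.symm j) v) := by
  induction v using TensorProduct.induction_on with
  | zero => simp
  | tmul m n =>
    obtain ⟨f, rfl⟩ := cls_surj m
    rw [Gact, TensorProduct.congr_tmul, quotPerm_cls, phi_tmul, phi_tmul, psi_cls, psi_cls,
      map_smul]
  | add a b ha hb => simp only [map_add, ha, hb]

lemma phi_FF (i j : Fin 6) (f : Fin 6 → Fin 4) : phi i j (FF f) = nn (f i) - nn (f j) := by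
  unfold FF
  simp only [map_sum, phi_tmul, mm, psi_cls, sub_smul, Finset.sum_sub_distrib]
  simp [Pi.single_apply]

lemma phi_FF_zero (i j : Fin 6) (f : Fin 6 → Fin 4) : phi i j (FF f) = 0 ↔ f i = f j := by
  rw [phi_FF, sub_eq_zero]
  exact ⟨nn_inj _ _, fun h => by rw [h]⟩

/-- The invariant: the sum of the cubes of the sizes of the colour classes. -/
noncomputable def inv3 (v : Vspace) : ℕ :=
  Nat.card {t : Fin 6 × Fin 6 × Fin 6 // phi t.1 t.2.1 v = 0 ∧ phi t.1 t.2.2 v = 0}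

lemma inv3_Gact (g : Equiv.Perm (Fin 6) × Equiv.Perm (Fin 3)) (v : Vspace) :
    inv3 (Gact g v) = inv3 v := by
  unfold inv3
  refine Nat.card_congr (Equiv.subtypeEquiv
    (g.1.symm.prodCongr (g.1.symm.prodCongr g.1.symm)) ?_)
  rintro ⟨i, j, k⟩
  simp [phi_Gact]

lemma inv3_FF (f : Fin 6 → Fin 4) : inv3 (FF f) =
    Fintype.card {t : Fin 6 × Fin 6 × Fin 6 // f t.1 = f t.2.1 ∧ f t.1 = f t.2.2} := by
  unfold inv3
  simp only [phi_FF_zero]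
  rw [Nat.card_eq_fintype_card]

/-- The eight representatives, one for each partition of 6 into 2, 3 or 4 parts. -/
def rep : Fin 8 → Fin 6 → Fin 4 :=
  ![![3, 3, 3, 3, 3, 2], ![3, 3, 3, 3, 2, 2], ![3, 3, 3, 2, 2, 2], ![3, 3, 3, 3, 2, 1],
    ![3, 3, 3, 2, 2, 1], ![3, 3, 2, 2, 1, 1], ![3, 3, 3, 2, 1, 0], ![3, 3, 2, 2, 1, 0]]

/-- Size of a colour class. -/
def cnt (f : Fin 6 → Fin 4) (x : Fin 4) : ℕ := Fintype.card {i // f i = x}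

lemma exists_perm_of_cnt (f h : Fin 6 → Fin 4) (H : ∀ x, cnt f x = cnt h x) :
    ∃ s : Equiv.Perm (Fin 6), ∀ i, f (s.symm i) = h i := by
  have e : ∀ x, {i // h i = x} ≃ {i // f i = x} := fun x => Fintype.equivOfCardEq (H x).symm
  let E : Equiv.Perm (Fin 6) := (Equiv.sigmaFiberEquiv h).symm.trans
    ((Equiv.sigmaCongrRight e).trans (Equiv.sigmaFiberEquiv f))
  exact ⟨E.symm, fun i => (e (h i) ⟨i, rfl⟩).2⟩

lemma sum_cnt (f : Fin 6 → Fin 4) : ∑ x, cnt f x = 6 := by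
  have := Fintype.card_congr (Equiv.sigmaFiberEquiv f)
  rw [Fintype.card_sigma] at this
  simpa [cnt] using this

set_option synthInstance.maxHeartbeats 400000 in
set_option synthInstance.maxSize 2000 in
set_option maxSynthPendingDepth 10 in
lemma cnt_cases (d : Fin 4 → ℕ) (hm : Monotone d) (hs : ∑ x, d x = 6) :
    (∀ x, d x = cnt (fun _ => 3) x) ∨ ∃ k, ∀ x, d x = cnt (rep k) x := by
  have h01 : d 0 ≤ d 1 := hm (by decide)
  have h12 : d 1 ≤ d 2 := hm (by decide)
  have h23 : d 2 ≤ d 3 := hm (by decide)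
  have key : ∀ a b c e : Fin 7, a ≤ b → b ≤ c → c ≤ e → a.1 + b.1 + c.1 + e.1 = 6 →
      (∀ x : Fin 4, (![a.1, b.1, c.1, e.1] : Fin 4 → ℕ) x = cnt (fun _ => 3) x) ∨
        ∃ k : Fin 8, ∀ x : Fin 4, (![a.1, b.1, c.1, e.1] : Fin 4 → ℕ) x = cnt (rep k) x := by
    decide +kernel
  rw [Fin.sum_univ_four] at hs
  have := key ⟨d 0, by omega⟩ ⟨d 1, by omega⟩ ⟨d 2, by omega⟩ ⟨d 3, by omega⟩ h01 h12 h23 hs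
  have hd : (![d 0, d 1, d 2, d 3] : Fin 4 → ℕ) = d := by
    ext x
    fin_cases x <;> rfl
  simpa only [hd] using this

lemma exists_rep (f : Fin 6 → Fin 4) (hf : FF f ≠ 0) : ∃ k g, Gact g (FF f) = FF (rep k) := by
  let p := Tuple.sort (cnt f)
  let f' : Fin 6 → Fin 4 := fun i => p.symm (f i)
  have hc : ∀ x, cnt f' x = (cnt f ∘ p) x := by
    intro x
    change Fintype.card {i // p.symm (f i) = x} = Fintype.card {i // f i = p x}
    refine Fintype.card_congr (Equiv.subtypeEquivRight fun i => ?_)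
    exact Equiv.symm_apply_eq p
  have hs : ∑ x, (cnt f ∘ p) x = 6 := by
    rw [← sum_cnt f]
    exact Equiv.sum_comp p (cnt f)
  have main : ∀ h : Fin 6 → Fin 4, (∀ x, (cnt f ∘ p) x = cnt h x) →
      ∃ g, Gact g (FF f) = FF h := by
    intro h H
    obtain ⟨s, hs⟩ := exists_perm_of_cnt f' h (fun x => (hc x).trans (H x))
    obtain ⟨t, ht⟩ := Gact_FF s p.symm f
    refine ⟨(s, t), ht.trans ?_⟩
    congr 1
    ext1 i
    exact hs i
  rcases cnt_cases _ (Tuple.monotone_sort (cnt f)) hs with H | ⟨k, H⟩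
  · obtain ⟨g, hg⟩ := main _ H
    rw [FF_const] at hg
    exact absurd ((LinearEquiv.map_eq_zero_iff _).1 hg) hf
  · exact ⟨k, main _ H⟩

lemma rep_ne (k : Fin 8) : FF (rep k) ≠ 0 := by
  have h : ∀ k, ∃ i j, rep k i ≠ rep k j := by decide
  obtain ⟨i, j, hij⟩ := h k
  intro h0
  apply hij
  rw [← phi_FF_zero, h0, map_zero]

lemma rep_inv_inj : ∀ k l : Fin 8, inv3 (FF (rep k)) = inv3 (FF (rep l)) → k = l := by
  simp only [inv3_FF]
  decide +kernel

/-- The action of `Perm (Fin 6) × Perm (Fin 3)` on the nonzero vectors of `V = M ⊗ N`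
has exactly 8 orbits: the 8 types of geometric hyperplanes of L₃ × GQ(2,2). -/
theorem hyperplane_orbits :
    Nat.card (Quot (fun (v w : {v : Vspace // v ≠ 0}) =>
      ∃ g : Equiv.Perm (Fin 6) × Equiv.Perm (Fin 3), Gact g v.1 = w.1)) = 8 := by
  let r := fun (v w : {v : Vspace // v ≠ 0}) =>
      ∃ g : Equiv.Perm (Fin 6) × Equiv.Perm (Fin 3), Gact g v.1 = w.1
  let q : Fin 8 → Quot r := fun k => Quot.mk r ⟨FF (rep k), rep_ne k⟩
  let I : Quot r → ℕ := Quot.lift (fun v => inv3 v.1) (by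
    rintro v w ⟨g, hg⟩
    rw [← hg, inv3_Gact])
  have hq : Function.Bijective q := by
    constructor
    · intro k l h
      exact rep_inv_inj k l (congrArg I h)
    · intro x
      induction x using Quot.ind with
      | mk v =>
        obtain ⟨v, hv⟩ := v
        obtain ⟨f, rfl⟩ := FF_surj v
        obtain ⟨k, g, hg⟩ := exists_rep f hv
        exact ⟨k, (Quot.sound ⟨g, hg⟩).symm⟩
  change Nat.card (Quot r) = 8
  rw [← Nat.card_congr (Equiv.ofBijective q hq)]
  simp
end

section
/- Let M be the quotient of (Fin 6 → ZMod 2) by the span of the constant function 1, N the quotient of (Fin 3 → ZMod 2) by the span of the constant function 1, and V = M ⊗[ZMod 2] N, with the action of Perm (Fin 6) × Perm (Fin 3) induced by permuting coordinates. Then the multiset of cardinalities of the orbits of this action on the nonzero vectors of V is {18, 30, 45, 90, 90, 120, 270, 360}. -/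
open TensorProduct

instance : Finite Vspace := Module.finite_of_finite (ZMod 2)

/-- The nonzero vectors of `V`. -/
abbrev VNZ := {v : Vspace // v ≠ 0}

/-- The orbit relation of `Perm (Fin 6) × Perm (Fin 3)` on the nonzero vectors of `V`. -/
def orbRel (v w : VNZ) : Prop :=
  ∃ g : Equiv.Perm (Fin 6) × Equiv.Perm (Fin 3), Gact g v.1 = w.1

abbrev KK := ZMod 2 × ZMod 2

/-- size of a fibre -/
def nfib (F : Fin 6 → KK) (x : KK) : ℕ := (Finset.univ.filter (fun i => F i = x)).card

/-- sum of cubes of the fibre sizes -/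
def cub (F : Fin 6 → KK) : ℕ :=
  nfib F (0,0) ^ 3 + nfib F (0,1) ^ 3 + nfib F (1,0) ^ 3 + nfib F (1,1) ^ 3

def KF : Finset (KK × KK × KK × KK × KK) := Finset.univ

def tup (p : KK × KK × KK × KK × KK) : Fin 5 → KK := ![p.1, p.2.1, p.2.2.1, p.2.2.2.1, p.2.2.2.2]

def tupE : (KK × KK × KK × KK × KK) ≃ (Fin 5 → KK) where
  toFun := tup
  invFun f := (f 0, f 1, f 2, f 3, f 4)
  left_inv p := rfl
  right_inv f := by
    funext i
    fin_cases i <;> rfl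

def cp (p : KK × KK × KK × KK × KK) : ℕ := cub (Fin.cons 0 (tup p))

lemma counts : ([126, 72, 54, 66, 36, 24, 30, 18].map
    (fun k => (Finset.univ.filter (fun p => cp p = k)).card)) =
    [18, 45, 30, 90, 360, 90, 120, 270] := by
  decide +kernel

lemma cp_values : ∀ p, cp p = 216 ∨ cp p ∈ [126, 72, 54, 66, 36, 24, 30, 18] := by
  decide +kernel

lemma cub_zero : cub 0 = 216 := by decide +kernel

/-- the partition with given sum of cubes -/
def ptab (k : ℕ) : ℕ × ℕ × ℕ × ℕ :=
  if k = 216 then (0,0,0,6) else if k = 126 then (0,0,1,5) else if k = 72 then (0,0,2,4)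
  else if k = 54 then (0,0,3,3) else if k = 66 then (0,1,1,4) else if k = 36 then (0,1,2,3)
  else if k = 24 then (0,2,2,2) else if k = 30 then (1,1,1,3) else (1,1,2,2)

lemma ptab_fin : ∀ a b c d : Fin 7, (a : ℕ) + b + c + d = 6 → a ≤ b → b ≤ c → c ≤ d →
    ptab ((a : ℕ)^3 + (b : ℕ)^3 + (c : ℕ)^3 + (d : ℕ)^3) = ((a : ℕ), (b : ℕ), (c : ℕ), (d : ℕ)) := by
  decide +kernel

lemma ptab_spec (a b c d : ℕ) (h : a + b + c + d = 6) (h1 : a ≤ b) (h2 : b ≤ c) (h3 : c ≤ d) :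
    ptab (a^3 + b^3 + c^3 + d^3) = (a, b, c, d) :=
  ptab_fin ⟨a, by omega⟩ ⟨b, by omega⟩ ⟨c, by omega⟩ ⟨d, by omega⟩ h h1 h2 h3

def e4 : Fin 4 ≃ KK where
  toFun := ![(0,0), (0,1), (1,0), (1,1)]
  invFun x := if x = (0,0) then 0 else if x = (0,1) then 1 else if x = (1,0) then 2 else 3
  left_inv := by decide
  right_inv := by decide

lemma cub_eq (F : Fin 6 → KK) : cub F = ∑ x : KK, nfib F x ^ 3 := by
  rw [← e4.sum_comp, Fin.sum_univ_four]; rfl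

lemma nfib_sum (F : Fin 6 → KK) : ∑ x : KK, nfib F x = 6 := by
  have := Finset.card_eq_sum_card_fiberwise (f := F) (s := Finset.univ) (t := Finset.univ)
    (fun _ _ => Finset.mem_coe.2 (Finset.mem_univ _))
  simpa [nfib] using this.symm

lemma nfib_sort (F : Fin 6 → KK) : ∃ e : Fin 4 ≃ KK, ∀ i,
    nfib F (e i) = ![(ptab (cub F)).1, (ptab (cub F)).2.1, (ptab (cub F)).2.2.1,
      (ptab (cub F)).2.2.2] i := by
  let s := Tuple.sort (fun i => nfib F (e4 i))
  have hm : Monotone ((fun i => nfib F (e4 i)) ∘ s) := Tuple.monotone_sort _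
  refine ⟨s.trans e4, ?_⟩
  have hs := nfib_sum F
  have hc := cub_eq F
  rw [← (s.trans e4).sum_comp, Fin.sum_univ_four] at hs hc
  have := ptab_spec _ _ _ _ hs (hm (show (0 : Fin 4) ≤ 1 by decide))
    (hm (show (1 : Fin 4) ≤ 2 by decide)) (hm (show (2 : Fin 4) ≤ 3 by decide))
  rw [← hc] at this
  rw [this]
  intro i
  fin_cases i <;> rfl

lemma cub_trans (F G : Fin 6 → KK) (h : cub F = cub G) :
    ∃ (σ : Equiv.Perm (Fin 6)) (π : Equiv.Perm KK), ∀ i, G (σ i) = π (F i) := by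
  obtain ⟨e, he⟩ := nfib_sort F
  obtain ⟨e', he'⟩ := nfib_sort G
  rw [← h] at he'
  let π : Equiv.Perm KK := e.symm.trans e'
  have hn : ∀ x, nfib F x = nfib G (π x) := by
    intro x
    have h1 := he (e.symm x)
    have h2 := he' (e.symm x)
    rw [← h2] at h1
    simpa [π] using h1
  have hq : ∀ x, Nonempty ({i // π (F i) = x} ≃ {i // G i = x}) := by
    intro x
    refine Fintype.card_eq.1 ?_
    have := hn (π.symm x)
    rw [Equiv.apply_symm_apply] at this
    rw [Fintype.card_subtype, Fintype.card_subtype]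
    unfold nfib at this
    rw [← this]
    congr 1
    ext i
    simp [Equiv.eq_symm_apply]
  let σ := Equiv.ofFiberEquiv (f := fun i => π (F i)) (g := G) (fun x => (hq x).some)
  exact ⟨σ, π, fun i => Equiv.ofFiberEquiv_map (f := fun i => π (F i)) (g := G) _ i⟩

lemma cub_inv (F : Fin 6 → KK) (σ : Equiv.Perm (Fin 6)) (π : Equiv.Perm KK) :
    cub (fun i => π (F (σ i))) = cub F := by
  rw [cub_eq, cub_eq, ← Equiv.sum_comp π]
  refine Finset.sum_congr rfl fun x _ => ?_
  congr 1
  unfold nfib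
  refine Finset.card_bij (fun i _ => σ i) ?_ ?_ ?_
  · intro i hi; simpa using hi
  · intro i _ j _ h; exact σ.injective h
  · intro j hj; exact ⟨σ.symm j, by simpa using hj, by simp⟩

def nuL : KK →ₗ[ZMod 2] (Fin 3 → ZMod 2) where
  toFun x := ![x.1, x.2, 0]
  map_add' x y := by ext i; fin_cases i <;> simp
  map_smul' a x := by ext i; fin_cases i <;> simp

def nu0 : KK →ₗ[ZMod 2] Nspace := (constSpan 3).mkQ ∘ₗ nuL

lemma nu0_inj : Function.Injective nu0 := by
  rw [injective_iff_map_eq_zero]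
  intro x hx
  have : nuL x ∈ constSpan 3 := (Submodule.Quotient.mk_eq_zero _).1 hx
  obtain ⟨c, hc⟩ := (mem_constSpan _).1 this
  have h0 := hc 0
  have h1 := hc 1
  have h2 := hc 2
  simp [nuL] at h0 h1 h2
  ext
  · simp [h0, h2]
  · simp [h1, h2]

lemma nu0_surj : Function.Surjective nu0 := by
  intro y
  obtain ⟨g, rfl⟩ := Submodule.Quotient.mk_surjective _ y
  refine ⟨(g 0 - g 2, g 1 - g 2), ?_⟩
  refine (Submodule.Quotient.eq _).2 ((mem_constSpan _).2 ⟨- g 2, fun i => ?_⟩)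
  fin_cases i <;> simp [nuL]

noncomputable def nu : KK ≃ₗ[ZMod 2] Nspace := LinearEquiv.ofBijective nu0 ⟨nu0_inj, nu0_surj⟩

lemma nu_apply (x : KK) : nu x = Submodule.Quotient.mk (nuL x) := rfl

set_option synthInstance.maxHeartbeats 400000 in
set_option synthInstance.maxSize 4000 in
lemma perm_KK_aux : ∀ a b c d : KK, a ≠ b → a ≠ c → a ≠ d → b ≠ c → b ≠ d → c ≠ d →
    ∃ τ : Equiv.Perm (Fin 3), ∀ i : Fin 4, ∃ z : ZMod 2, ∀ j : Fin 3,
      (![(![a, b, c, d] i).1, (![a, b, c, d] i).2, 0] : Fin 3 → ZMod 2) j - (![a.1, a.2, 0] : Fin 3 → ZMod 2) j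
        - (![(e4 i).1, (e4 i).2, 0] : Fin 3 → ZMod 2) (τ.symm j) = z := by
  decide +kernel

lemma quotPerm_mk {n : ℕ} (σ : Equiv.Perm (Fin n)) (f : Fin n → ZMod 2) :
    quotPerm σ (Submodule.Quotient.mk f) = Submodule.Quotient.mk (fun i => f (σ.symm i)) := rfl

lemma perm_KK (π : Equiv.Perm KK) : ∃ (τ : Equiv.Perm (Fin 3)) (k : KK), ∀ x,
    nu (π x) = nu k + quotPerm τ (nu x) := by
  have hne : ∀ {i j : Fin 4}, i ≠ j → π (e4 i) ≠ π (e4 j) := fun h h' =>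
    h (e4.injective (π.injective h'))
  obtain ⟨τ, hτ⟩ := perm_KK_aux (π (e4 0)) (π (e4 1)) (π (e4 2)) (π (e4 3))
    (hne (by decide)) (hne (by decide)) (hne (by decide)) (hne (by decide)) (hne (by decide))
    (hne (by decide))
  refine ⟨τ, π (e4 0), fun x => ?_⟩
  obtain ⟨i, rfl⟩ := e4.surjective x
  obtain ⟨z, hz⟩ := hτ i
  rw [nu_apply, nu_apply, nu_apply, quotPerm_mk, ← Submodule.Quotient.mk_add,
    Submodule.Quotient.eq, mem_constSpan]
  refine ⟨z, fun j => ?_⟩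
  have hi : (![π (e4 0), π (e4 1), π (e4 2), π (e4 3)] : Fin 4 → KK) i = π (e4 i) := by
    fin_cases i <;> rfl
  have := hz j
  rw [hi, sub_sub] at this
  exact this

noncomputable def eM (i : Fin 6) : Mspace := Submodule.Quotient.mk (Pi.single i 1)

lemma sum_eM (f : Fin 6 → ZMod 2) : ∑ i, f i • eM i = (Submodule.Quotient.mk f : Mspace) := by
  have : f = ∑ i, f i • (Pi.single i 1 : Fin 6 → ZMod 2) := by
    ext j; simp [Finset.sum_apply, Pi.single_apply]
  conv_rhs => rw [this]
  rw [← Submodule.mkQ_apply, map_sum]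
  rfl

lemma quotPerm_eM (σ : Equiv.Perm (Fin 6)) (i : Fin 6) : quotPerm σ (eM i) = eM (σ i) := by
  unfold eM
  rw [quotPerm_mk]
  congr 1
  ext j
  simp [Pi.single_apply, Equiv.symm_apply_eq]

noncomputable def PP (F : Fin 6 → KK) : Vspace := ∑ i, eM i ⊗ₜ[ZMod 2] nu (F i)

lemma PP_add (F G : Fin 6 → KK) : PP (F + G) = PP F + PP G := by
  simp [PP, TensorProduct.tmul_add, Finset.sum_add_distrib]

lemma PP_const (k : KK) : PP (fun _ => k) = 0 := by
  unfold PP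
  rw [← TensorProduct.sum_tmul]
  have h := sum_eM (fun _ => 1)
  simp only [one_smul] at h
  rw [h, (Submodule.Quotient.mk_eq_zero _).2 ((mem_constSpan _).2 ⟨1, fun _ => rfl⟩),
    TensorProduct.zero_tmul]

lemma PP_zero : PP 0 = 0 := PP_const 0

lemma PP_surj : Function.Surjective PP := by
  intro v
  induction v using TensorProduct.induction_on with
  | zero => exact ⟨0, PP_zero⟩
  | tmul x y =>
    obtain ⟨f, rfl⟩ := Submodule.Quotient.mk_surjective _ x
    obtain ⟨k, rfl⟩ := nu.surjective y
    refine ⟨fun i => f i • k, ?_⟩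
    rw [← sum_eM, TensorProduct.sum_tmul]
    unfold PP
    refine Finset.sum_congr rfl fun i _ => ?_
    rw [map_smul, TensorProduct.smul_tmul]
  | add x y hx hy =>
    obtain ⟨F, rfl⟩ := hx
    obtain ⟨G, rfl⟩ := hy
    exact ⟨F + G, PP_add F G⟩

lemma Gact_PP (g : Equiv.Perm (Fin 6) × Equiv.Perm (Fin 3)) (F : Fin 6 → KK) :
    Gact g (PP F) = PP (fun i => nu.symm (quotPerm g.2 (nu (F (g.1.symm i))))) := by
  unfold PP Gact
  rw [map_sum]
  refine Eq.trans ?_ (Equiv.sum_comp g.1 _)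
  refine Finset.sum_congr rfl fun i _ => ?_
  simp [quotPerm_eM]

lemma finrank_quot (n : ℕ) : Module.finrank (ZMod 2) ((Fin (n+1) → ZMod 2) ⧸ constSpan (n+1)) = n := by
  have h := Submodule.finrank_quotient_add_finrank (constSpan (n+1))
  have h1 : Module.finrank (ZMod 2) (constSpan (n+1)) = 1 := by
    unfold constSpan
    refine finrank_span_singleton ?_
    intro h
    have := congrFun h 0
    simp at this
  rw [h1] at h
  simp at h
  exact h

lemma card_V : Nat.card Vspace = 1024 := by
  rw [Module.natCard_eq_pow_finrank (K := ZMod 2), Module.finrank_tensorProduct,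
    finrank_quot 5, finrank_quot 2]
  simp

noncomputable def RR (p : KK × KK × KK × KK × KK) : Vspace := PP (Fin.cons 0 (tup p))

lemma PP_norm (F : Fin 6 → KK) : ∃ p, RR p = PP F ∧ cp p = cub F := by
  refine ⟨tupE.symm (fun i => F i.succ + F 0), ?_⟩
  have hF : (Fin.cons 0 (tup (tupE.symm (fun i => F i.succ + F 0))) : Fin 6 → KK)
      = fun i => F i + F 0 := by
    have : tup (tupE.symm (fun i => F i.succ + F 0)) = fun i => F i.succ + F 0 :=
      tupE.apply_symm_apply _
    rw [this]
    funext i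
    refine Fin.cases ?_ (fun j => ?_) i
    · have : ∀ k : KK, (0 : KK) = k + k := by decide
      exact this _
    · rfl
  constructor
  · unfold RR
    rw [hF]
    have := PP_add F (fun _ => F 0)
    rw [PP_const, add_zero] at this
    exact this
  · unfold cp
    rw [hF]
    exact cub_inv F 1 (Equiv.addRight (F 0))

lemma RR_bij : Function.Bijective RR := by
  rw [Nat.bijective_iff_surjective_and_card]
  refine ⟨fun v => ?_, ?_⟩
  · obtain ⟨F, rfl⟩ := PP_surj v
    obtain ⟨p, hp, _⟩ := PP_norm F
    exact ⟨p, hp⟩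
  · rw [card_V]; simp

noncomputable def RE : (KK × KK × KK × KK × KK) ≃ Vspace := Equiv.ofBijective RR RR_bij

noncomputable def cV (v : Vspace) : ℕ := cp (RE.symm v)

lemma cV_PP (F : Fin 6 → KK) : cV (PP F) = cub F := by
  obtain ⟨p, hp, hc⟩ := PP_norm F
  have : RE p = PP F := hp
  rw [← hc, ← this, cV, Equiv.symm_apply_apply]

lemma cV_Gact (g : Equiv.Perm (Fin 6) × Equiv.Perm (Fin 3)) (v : Vspace) :
    cV (Gact g v) = cV v := by
  obtain ⟨F, rfl⟩ := PP_surj v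
  rw [Gact_PP, cV_PP, cV_PP]
  exact cub_inv F g.1.symm ((nu.trans ((quotPerm g.2).trans nu.symm)).toEquiv)

lemma cV_trans (v w : Vspace) (h : cV v = cV w) : ∃ g, Gact g v = w := by
  obtain ⟨F, rfl⟩ := PP_surj v
  obtain ⟨G, rfl⟩ := PP_surj w
  rw [cV_PP, cV_PP] at h
  obtain ⟨σ, π, hG⟩ := cub_trans F G h
  obtain ⟨τ, k, hπ⟩ := perm_KK π
  refine ⟨(σ, τ), ?_⟩
  rw [Gact_PP]
  have : G = (fun _ => k) + (fun i => nu.symm (quotPerm τ (nu (F (σ.symm i))))) := by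
    funext i
    apply nu.injective
    have := hG (σ.symm i)
    rw [Equiv.apply_symm_apply] at this
    rw [this, hπ]
    simp
  rw [this, PP_add, PP_const, zero_add]

lemma cV_zero_iff (v : Vspace) : cV v = 216 ↔ v = 0 := by
  have h0 : cV 0 = 216 := by rw [← PP_zero, cV_PP, cub_zero]
  constructor
  · intro h
    obtain ⟨g, hg⟩ := cV_trans 0 v (h0.trans h.symm)
    rw [← hg, map_zero]
  · rintro rfl; exact h0

noncomputable def cQ : Quot orbRel → ℕ :=
  Quot.lift (fun v => cV v.1) (by
    rintro v w ⟨g, hg⟩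
    show cV v.1 = cV w.1
    rw [← hg, cV_Gact])

lemma cQ_inj : Function.Injective cQ := by
  intro a b
  induction a using Quot.ind
  induction b using Quot.ind
  intro h
  exact Quot.sound (cV_trans _ _ h)

def hcount (k : ℕ) : ℕ := (Finset.univ.filter (fun p => cp p = k)).card

lemma cV_values (v : VNZ) : cV v.1 ∈ [126, 72, 54, 66, 36, 24, 30, 18] :=
  (cp_values (RE.symm v.1)).resolve_left (fun h => v.2 ((cV_zero_iff _).1 h))

lemma cQ_ne (q : Quot orbRel) : cQ q ∈ [126, 72, 54, 66, 36, 24, 30, 18] := by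
  induction q using Quot.ind
  exact cV_values _

lemma card_orbit (q : Quot orbRel) : Nat.card {v : VNZ // Quot.mk orbRel v = q} = hcount (cQ q) := by
  have hne : cQ q ≠ 216 := by
    intro h
    have := cQ_ne q
    rw [h] at this
    revert this
    decide
  unfold hcount
  rw [← Fintype.card_subtype, ← Nat.card_eq_fintype_card]
  refine Nat.card_congr ⟨fun v => ⟨RE.symm v.1.1, ?_⟩, fun p => ⟨⟨RE p.1, ?_⟩, ?_⟩, ?_, ?_⟩
  · exact congrArg cQ v.2
  · intro h
    have h1 := (cV_zero_iff _).2 h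
    rw [cV, Equiv.symm_apply_apply, p.2] at h1
    exact hne h1
  · apply cQ_inj
    show cV (RE p.1) = _
    rw [cV, Equiv.symm_apply_apply, p.2]
  · intro v
    ext
    simp
  · intro p
    ext1
    simp

lemma cQ_range : ∀ k ∈ [126, 72, 54, 66, 36, 24, 30, 18], ∃ q, cQ q = k := by
  intro k hk
  have hpos : ∀ k ∈ [126, 72, 54, 66, 36, 24, 30, 18], k ≠ 216 ∧
      0 < (Finset.univ.filter (fun p => cp p = k)).card := by
    have h := counts
    simp only [List.map_cons, List.map_nil, List.cons.injEq, and_true] at h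
    obtain ⟨h1, h2, h3, h4, h5, h6, h7, h8⟩ := h
    intro k hk
    simp only [List.mem_cons, List.not_mem_nil, or_false] at hk
    rcases hk with rfl | rfl | rfl | rfl | rfl | rfl | rfl | rfl <;>
      refine ⟨by decide, ?_⟩ <;> simp only [h1, h2, h3, h4, h5, h6, h7, h8] <;> decide
  obtain ⟨h216, hc⟩ := hpos k hk
  obtain ⟨p, hp⟩ := Finset.card_pos.1 hc
  have hp' : cp p = k := (Finset.mem_filter.1 hp).2
  have hv : cV (RE p) = k := by rw [cV, Equiv.symm_apply_apply, hp']
  refine ⟨Quot.mk _ ⟨RE p, fun h => h216 ?_⟩, hv⟩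
  rw [← hv]; exact (cV_zero_iff _).2 h

/-- The multiset of cardinalities of the orbits of `Perm (Fin 6) × Perm (Fin 3)` on the
nonzero vectors of `V = M ⊗ N` is `{18, 30, 45, 90, 90, 120, 270, 360}`. -/
theorem hyperplane_orbit_sizes :
    haveI : Fintype (Quot orbRel) := Fintype.ofFinite _
    (Finset.univ : Finset (Quot orbRel)).val.map
        (fun q => Nat.card {v : VNZ // Quot.mk orbRel v = q}) =
      ({18, 30, 45, 90, 90, 120, 270, 360} : Multiset ℕ) := by
  have h1 : (fun q => Nat.card {v : VNZ // Quot.mk orbRel v = q}) = hcount ∘ cQ :=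
    funext card_orbit
  have h2 : (@Finset.univ _ (Fintype.ofFinite _) : Finset (Quot orbRel)).val.map cQ
      = (([126, 72, 54, 66, 36, 24, 30, 18] : List ℕ) : Multiset ℕ) := by
    refine (Multiset.Nodup.ext (Multiset.Nodup.map cQ_inj (Finset.nodup _)) ?_).2 fun k => ?_
    · exact Multiset.coe_nodup.2 (by decide)
    · rw [Multiset.mem_map, Multiset.mem_coe]
      constructor
      · rintro ⟨q, _, rfl⟩; exact cQ_ne q
      · intro hk
        obtain ⟨q, hq⟩ := cQ_range k hk
        exact ⟨q, @Finset.mem_univ _ (Fintype.ofFinite _) q, hq⟩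
  rw [h1, ← Multiset.map_map, h2, Multiset.map_coe]
  have h3 : List.map hcount [126, 72, 54, 66, 36, 24, 30, 18] =
    [18, 45, 30, 90, 360, 90, 120, 270] := counts
  rw [h3]
  decide
end

section
/- The near hexagon L3×GQ(2,2) has exactly 1023 geometric hyperplanes; that is, the number of proper subsets H of its point set such that every line meets H in exactly 1 or exactly 3 of its points equals 2^10 − 1 = 1023. -/
/-- The points of GQ(2,2): the 2-element subsets of `Fin 6`. -/
abbrev GQP : Type := {s : Finset (Fin 6) // s.card = 2}

/-- The lines of GQ(2,2): 3-element sets of pairwise disjoint 2-element subsets of `Fin 6`. -/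
def GQLine (L : Finset GQP) : Prop :=
  L.card = 3 ∧ ∀ p ∈ L, ∀ q ∈ L, p ≠ q → Disjoint p.1 q.1

/-- The points of the near hexagon L₃ × GQ(2,2). -/
abbrev NHP : Type := Fin 3 × GQP

/-- The lines of L₃ × GQ(2,2): type-one lines `{(i, q) : i ∈ Fin 3}` for a fixed point `q`
of GQ(2,2), and type-two lines `{(i, q) : q ∈ L}` for a fixed `i` and a line `L` of GQ(2,2). -/
def NHLine (X : Finset NHP) : Prop :=
  (∃ q : GQP, X = Finset.univ.image (fun i : Fin 3 => (i, q))) ∨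
  (∃ (i : Fin 3) (L : Finset GQP), GQLine L ∧ X = L.image (fun q => (i, q)))

/-- A geometric hyperplane of L₃ × GQ(2,2): a proper subset of the point set meeting
every line in exactly 1 or exactly 3 of its points. -/
def NHHyp (H : Finset NHP) : Prop :=
  H ≠ Finset.univ ∧ ∀ X : Finset NHP, NHLine X → (X ∩ H).card = 1 ∨ (X ∩ H).card = 3

/-- Functions on GQ(2,2) summing to zero on every line. -/
def IsW (f : GQP → ZMod 2) : Prop := ∀ L, GQLine L → ∑ q ∈ L, f q = 0

/-- The function attached to a weight on `Fin 6`. -/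
def fu (g : Fin 6 → ZMod 2) (q : GQP) : ZMod 2 := ∑ a ∈ q.1, g a + ∑ a, g a

lemma two_zmod (x : ZMod 2) : x + x = 0 := by revert x; decide

lemma isW_fu (g : Fin 6 → ZMod 2) : IsW (fu g) := by
  intro L hL
  obtain ⟨h3, hd⟩ := hL
  have hpd : Set.PairwiseDisjoint (L : Set GQP) (fun q : GQP => q.1) :=
    fun p hp q hq hpq => hd p hp q hq hpq
  have hU : L.biUnion (fun q : GQP => q.1) = Finset.univ := by
    rw [← Finset.card_eq_iff_eq_univ, Finset.card_biUnion hpd,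
      Finset.sum_congr rfl (fun q _ => q.2)]
    simp [h3]
  have := Finset.sum_biUnion (f := g) hpd
  rw [hU] at this
  unfold fu
  rw [Finset.sum_add_distrib, ← this, Finset.sum_const, h3]
  generalize ∑ a, g a = s
  revert s; decide

/-- The point `{a, b}` of GQ(2,2). -/
def pt (a b : Fin 6) (h : a ≠ b) : GQP := ⟨{a, b}, Finset.card_pair h⟩

/-- Five coordinates. -/
def co (f : GQP → ZMod 2) : Fin 5 → ZMod 2 :=
  ![f (pt 0 1 (by decide)), f (pt 0 2 (by decide)), f (pt 0 3 (by decide)),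
    f (pt 0 4 (by decide)), f (pt 1 2 (by decide))]

lemma line_sum {f : GQP → ZMod 2} (hf : IsW f) (p q r : GQP)
    (h1 : Disjoint p.1 q.1) (h2 : Disjoint p.1 r.1) (h3 : Disjoint q.1 r.1) :
    f r = f p + f q := by
  have key : ∀ p q : GQP, Disjoint p.1 q.1 → p ≠ q := by
    rintro p q h rfl
    have h2 := p.2
    rw [disjoint_self.mp h] at h2
    simp at h2
  have n1 := key _ _ h1
  have n2 := key _ _ h2
  have n3 := key _ _ h3
  have hL : GQLine {p, q, r} := by
    refine ⟨Finset.card_eq_three.mpr ⟨p, q, r, n1, n2, n3, rfl⟩, ?_⟩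
    intro x hx y hy hxy
    simp only [Finset.mem_insert, Finset.mem_singleton] at hx hy
    rcases hx with rfl | rfl | rfl <;> rcases hy with rfl | rfl | rfl <;>
      first | exact absurd rfl hxy | assumption | (apply Disjoint.symm; assumption)
  have := hf _ hL
  rw [Finset.sum_insert (by simp [n1, n2]), Finset.sum_pair n3] at this
  generalize f p = x at *
  generalize f q = y at *
  generalize f r = z at *
  revert x y z; decide

lemma all_pt : ∀ q : GQP, q ∈ ({pt 0 1 (by decide), pt 0 2 (by decide), pt 0 3 (by decide),
    pt 0 4 (by decide), pt 0 5 (by decide), pt 1 2 (by decide), pt 1 3 (by decide),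
    pt 1 4 (by decide), pt 1 5 (by decide), pt 2 3 (by decide), pt 2 4 (by decide),
    pt 2 5 (by decide), pt 3 4 (by decide), pt 3 5 (by decide), pt 4 5 (by decide)} :
    Finset GQP) := by
  rintro ⟨s, hs⟩
  simp only [Finset.mem_insert, Finset.mem_singleton, pt, Subtype.mk.injEq]
  revert s
  decide

lemma co_inj {f g : GQP → ZMod 2} (hf : IsW f) (hg : IsW g) (h : co f = co g) : f = g := by
  have e01 : f (pt 0 1 (by decide)) = g (pt 0 1 (by decide)) := congrFun h 0
  have e02 : f (pt 0 2 (by decide)) = g (pt 0 2 (by decide)) := congrFun h 1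
  have e03 : f (pt 0 3 (by decide)) = g (pt 0 3 (by decide)) := congrFun h 2
  have e04 : f (pt 0 4 (by decide)) = g (pt 0 4 (by decide)) := congrFun h 3
  have e12 : f (pt 1 2 (by decide)) = g (pt 1 2 (by decide)) := congrFun h 4
  have st : ∀ p q r : GQP, f p = g p → f q = g q → Disjoint p.1 q.1 → Disjoint p.1 r.1 →
      Disjoint q.1 r.1 → f r = g r := by
    intro p q r hp hq h1 h2 h3
    rw [line_sum hf p q r h1 h2 h3, line_sum hg p q r h1 h2 h3, hp, hq]
  have e45 := st _ _ (pt 4 5 (by decide)) e12 e03 (by decide) (by decide) (by decide)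
  have e35 := st _ _ (pt 3 5 (by decide)) e12 e04 (by decide) (by decide) (by decide)
  have e23 := st _ _ (pt 2 3 (by decide)) e01 e45 (by decide) (by decide) (by decide)
  have e13 := st _ _ (pt 1 3 (by decide)) e02 e45 (by decide) (by decide) (by decide)
  have e24 := st _ _ (pt 2 4 (by decide)) e01 e35 (by decide) (by decide) (by decide)
  have e14 := st _ _ (pt 1 4 (by decide)) e02 e35 (by decide) (by decide) (by decide)
  have e05 := st _ _ (pt 0 5 (by decide)) e23 e14 (by decide) (by decide) (by decide)
  have e25 := st _ _ (pt 2 5 (by decide)) e04 e13 (by decide) (by decide) (by decide)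
  have e15 := st _ _ (pt 1 5 (by decide)) e04 e23 (by decide) (by decide) (by decide)
  have e34 := st _ _ (pt 3 4 (by decide)) e05 e12 (by decide) (by decide) (by decide)
  funext q
  have hq := all_pt q
  simp only [Finset.mem_insert, Finset.mem_singleton] at hq
  rcases hq with rfl | rfl | rfl | rfl | rfl | rfl | rfl | rfl | rfl | rfl | rfl | rfl | rfl |
    rfl | rfl <;> assumption

lemma fu_pt (g : Fin 6 → ZMod 2) (a b : Fin 6) (h : a ≠ b) :
    fu g (pt a b h) = g a + g b + ∑ a, g a := by
  simp [fu, pt, Finset.sum_pair h]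

lemma co_surj (x : Fin 5 → ZMod 2) : ∃ f, IsW f ∧ co f = x := by
  let S := x 0 + x 1 + x 4
  let g0 := S + (x 0 + x 1 + x 2 + x 3)
  refine ⟨fu ![g0, g0 + x 0 + S, g0 + x 1 + S, g0 + x 2 + S, g0 + x 3 + S, 0], isW_fu _, ?_⟩
  funext i
  have key : ∀ a b c d e : ZMod 2, ∀ S, S = a + b + e → ∀ g0, g0 = S + (a + b + c + d) →
    (∀ T, T = g0 + (g0 + a + S) + (g0 + b + S) + (g0 + c + S) + (g0 + d + S) + 0 →
    (g0 + (g0 + a + S) + T = a ∧ g0 + (g0 + b + S) + T = b ∧ g0 + (g0 + c + S) + T = c ∧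
      g0 + (g0 + d + S) + T = d ∧ (g0 + a + S) + (g0 + b + S) + T = e)) := by decide
  obtain ⟨k0, k1, k2, k3, k4⟩ := key (x 0) (x 1) (x 2) (x 3) (x 4) S rfl g0 rfl _ rfl
  have hs : ∑ a, (![g0, g0 + x 0 + S, g0 + x 1 + S, g0 + x 2 + S, g0 + x 3 + S, 0] :
      Fin 6 → ZMod 2) a =
      g0 + (g0 + x 0 + S) + (g0 + x 1 + S) + (g0 + x 2 + S) + (g0 + x 3 + S) + 0 :=
    Fin.sum_univ_six _
  simp only [co, fu_pt, hs]
  fin_cases i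
  · exact k0
  · exact k1
  · exact k2
  · exact k3
  · exact k4

/-- Indicator of the complement. -/
def chi (H : Finset NHP) (x : NHP) : ZMod 2 := if x ∈ H then 0 else 1

lemma line_iff (H X : Finset NHP) (hX : X.card = 3) :
    ((X ∩ H).card = 1 ∨ (X ∩ H).card = 3) ↔ ∑ x ∈ X, chi H x = 0 := by
  obtain ⟨a, b, c, hab, hac, hbc, rfl⟩ := Finset.card_eq_three.mp hX
  rw [Finset.sum_insert (by simp [hab, hac]), Finset.sum_pair hbc]
  have h1 : (1 : ZMod 2) + 1 = 0 := by decide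
  have h2 : (1 : ZMod 2) + (1 + 1) ≠ 0 := by decide
  by_cases ha : a ∈ H <;> by_cases hb : b ∈ H <;> by_cases hc : c ∈ H <;>
    simp [chi, ha, hb, hc, Finset.insert_inter_of_mem, Finset.insert_inter_of_notMem,
      Finset.singleton_inter_of_mem, Finset.singleton_inter_of_notMem, hab, hac, hbc, h1]

lemma hyp_iff (H : Finset NHP) : NHHyp H ↔ H ≠ Finset.univ ∧
    (∀ i, IsW (fun q => chi H (i, q))) ∧
    ∀ q, chi H (0, q) + chi H (1, q) + chi H (2, q) = 0 := by
  have i1 : ∀ q : GQP, Function.Injective (fun i : Fin 3 => (i, q)) :=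
    fun q a b h => (Prod.mk.inj h).1
  have i2 : ∀ i : Fin 3, Function.Injective (fun q : GQP => (i, q)) :=
    fun q a b h => (Prod.mk.inj h).2
  have s1 : ∀ q : GQP, ∑ x ∈ Finset.univ.image (fun i : Fin 3 => (i, q)), chi H x =
      chi H (0, q) + chi H (1, q) + chi H (2, q) := by
    intro q
    rw [Finset.sum_image (fun a _ b _ h => i1 q h), Fin.sum_univ_three]
  have s2 : ∀ (i : Fin 3) (L : Finset GQP), ∑ x ∈ L.image (fun q => (i, q)), chi H x =
      ∑ q ∈ L, chi H (i, q) := by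
    intro i L
    rw [Finset.sum_image (fun a _ b _ h => i2 i h)]
  have c1 : ∀ q : GQP, (Finset.univ.image (fun i : Fin 3 => (i, q))).card = 3 := by
    intro q
    rw [Finset.card_image_of_injective _ (i1 q)]; rfl
  have c2 : ∀ (i : Fin 3) (L : Finset GQP), GQLine L →
      (L.image (fun q => (i, q))).card = 3 := by
    intro i L hL
    rw [Finset.card_image_of_injective _ (i2 i)]; exact hL.1
  unfold NHHyp
  refine and_congr_right fun _ => ⟨fun h => ⟨?_, ?_⟩, ?_⟩
  · intro i L hL
    rw [← s2, ← line_iff _ _ (c2 i L hL)]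
    exact h _ (Or.inr ⟨i, L, hL, rfl⟩)
  · intro q
    rw [← s1, ← line_iff _ _ (c1 q)]
    exact h _ (Or.inl ⟨q, rfl⟩)
  · rintro ⟨hw, hq⟩ X (⟨q, rfl⟩ | ⟨i, L, hL, rfl⟩)
    · rw [line_iff _ _ (c1 q), s1]; exact hq q
    · rw [line_iff _ _ (c2 i L hL), s2]; exact hw i L hL

lemma chi_inj {H K : Finset NHP} (h : chi H = chi K) : H = K := by
  ext x
  have := congrFun h x
  unfold chi at this
  by_cases h1 : x ∈ H <;> by_cases h2 : x ∈ K <;> simp_all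

lemma chi_univ : chi Finset.univ = 0 := by
  funext x; simp [chi]

lemma isW_zero : IsW 0 := by intro L _; simp

lemma co_zero : co 0 = 0 := by
  funext i; fin_cases i <;> rfl

/-- Coordinates of a hyperplane. -/
def crd (H : Finset NHP) : (Fin 5 → ZMod 2) × (Fin 5 → ZMod 2) :=
  (co fun q => chi H (0, q), co fun q => chi H (1, q))

lemma crd_inj {H K : Finset NHP} (hH : ∀ i, IsW (fun q => chi H (i, q)))
    (hH' : ∀ q, chi H (0, q) + chi H (1, q) + chi H (2, q) = 0)
    (hK : ∀ i, IsW (fun q => chi K (i, q)))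
    (hK' : ∀ q, chi K (0, q) + chi K (1, q) + chi K (2, q) = 0)
    (h : crd H = crd K) : H = K := by
  have h0 := co_inj (hH 0) (hK 0) (Prod.mk.inj h).1
  have h1 := co_inj (hH 1) (hK 1) (Prod.mk.inj h).2
  apply chi_inj
  funext ⟨i, q⟩
  have a0 := congrFun h0 q
  have a1 := congrFun h1 q
  have b := (hH' q).trans (hK' q).symm
  fin_cases i
  · exact a0
  · exact a1
  · rw [a0, a1] at b
    exact add_left_cancel b

lemma crd_univ : crd Finset.univ = 0 := by
  unfold crd
  rw [chi_univ]
  exact Prod.ext co_zero co_zero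

lemma crd_surj (y : (Fin 5 → ZMod 2) × (Fin 5 → ZMod 2)) : ∃ H : Finset NHP,
    (∀ i, IsW (fun q => chi H (i, q))) ∧
    (∀ q, chi H (0, q) + chi H (1, q) + chi H (2, q) = 0) ∧ crd H = y := by
  obtain ⟨f, hf, hfy⟩ := co_surj y.1
  obtain ⟨g, hg, hgy⟩ := co_surj y.2
  let F : Fin 3 → GQP → ZMod 2 := ![f, g, f + g]
  have hc : chi (Finset.univ.filter fun x : NHP => F x.1 x.2 = 0) = fun x => F x.1 x.2 := by
    funext x
    have : ∀ z : ZMod 2, (if z = 0 then (0 : ZMod 2) else 1) = z := by decide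
    simp only [chi, Finset.mem_filter, Finset.mem_univ, true_and]
    exact this _
  refine ⟨Finset.univ.filter fun x : NHP => F x.1 x.2 = 0, ?_, ?_, ?_⟩
  · rw [hc]
    intro i
    fin_cases i
    · exact hf
    · exact hg
    · intro L hL
      have := congrArg₂ (· + ·) (hf L hL) (hg L hL)
      simp only [← Finset.sum_add_distrib, add_zero] at this
      exact this
  · rw [hc]
    intro q
    exact two_zmod (f q + g q)
  · unfold crd
    rw [hc]
    exact Prod.ext hfy hgy

/-- The near hexagon L₃ × GQ(2,2) has exactly `2^10 - 1 = 1023` geometric hyperplanes. -/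
theorem card_NHHyp : Nat.card {H : Finset NHP // NHHyp H} = 2 ^ 10 - 1 ∧
    (2 ^ 10 - 1 : ℕ) = 1023 := by
  refine ⟨?_, by norm_num⟩
  have hz : crd Finset.univ = 0 := crd_univ
  have hu1 : ∀ i, IsW (fun q => chi Finset.univ (i, q)) := by
    rw [chi_univ]; exact fun _ => isW_zero
  have hu2 : ∀ q, chi Finset.univ (0, q) + chi Finset.univ (1, q) +
      chi Finset.univ (2, q) = 0 := by
    rw [chi_univ]; intro q; simp
  have hne : ∀ H : {H : Finset NHP // NHHyp H}, crd H.1 ≠ 0 := by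
    rintro ⟨H, hH⟩ h
    rw [hyp_iff] at hH
    exact hH.1 (crd_inj hH.2.1 hH.2.2 hu1 hu2 (h.trans hz.symm))
  let Φ : {H : Finset NHP // NHHyp H} →
      {y : (Fin 5 → ZMod 2) × (Fin 5 → ZMod 2) // y ≠ 0} := fun H => ⟨crd H.1, hne H⟩
  have hΦ : Function.Bijective Φ := by
    constructor
    · rintro ⟨H, hH⟩ ⟨K, hK⟩ h
      have h' : crd H = crd K := congrArg Subtype.val h
      rw [hyp_iff] at hH hK
      exact Subtype.ext (crd_inj hH.2.1 hH.2.2 hK.2.1 hK.2.2 h')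
    · rintro ⟨y, hy⟩
      obtain ⟨H, h1, h2, h3⟩ := crd_surj y
      refine ⟨⟨H, (hyp_iff H).mpr ⟨?_, h1, h2⟩⟩, Subtype.ext h3⟩
      rintro rfl
      exact hy (h3.symm.trans hz)
  rw [Nat.card_congr (Equiv.ofBijective Φ hΦ), Nat.card_eq_fintype_card,
    Fintype.card_subtype_compl, Fintype.card_subtype_eq]
  simp [ZMod.card]
end

section
/- The generalized quadrangle GQ(2,2) has exactly 31 geometric hyperplanes; that is, the number of proper subsets H of the set of 2-element subsets of Fin 6 such that every 3-element set of pairwise disjoint 2-element subsets of Fin 6 meets H in exactly 1 or exactly 3 of its elements equals 2^5 − 1 = 31. -/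
/-- A geometric hyperplane of GQ(2,2): a proper subset of the point set meeting
every line in exactly 1 or exactly 3 of its points. -/
def GQHyp (H : Finset GQP) : Prop :=
  H ≠ Finset.univ ∧ ∀ L : Finset GQP, GQLine L → (L ∩ H).card = 1 ∨ (L ∩ H).card = 3

/-- The hyperplane attached to a subset `A` of `Fin 6`. -/
def FH (A : Finset (Fin 6)) : Finset GQP :=
  Finset.univ.filter fun p => (p.1 ∩ A).card % 2 = A.card % 2

/-- Membership of the pair `{i, j}` in `H`. -/
def hb (H : Finset GQP) (i j : Fin 6) : Bool :=
  decide (∃ p ∈ H, p.1 = {i, j})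

/-- The set built from six membership bits. -/
def TT (x y0 y1 y2 y3 y4 : Bool) : Finset (Fin 6) :=
  let c := x ^^ y0 ^^ y1
  Finset.univ.filter fun i =>
    (i = 0 ∧ (y0 ^^ c) = true) ∨ (i = 1 ∧ (y1 ^^ c) = true) ∨ (i = 2 ∧ (y2 ^^ c) = true) ∨
    (i = 3 ∧ (y3 ^^ c) = true) ∨ (i = 4 ∧ (y4 ^^ c) = true)

/-- Recovers the subset from the hyperplane. -/
def RH (H : Finset GQP) : Finset (Fin 6) :=
  TT (hb H 0 1) (hb H 0 5) (hb H 1 5) (hb H 2 5) (hb H 3 5) (hb H 4 5)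

lemma hb_eq (H : Finset GQP) (i j : Fin 6) (h : ({i, j} : Finset (Fin 6)).card = 2) :
    hb H i j = decide ((⟨{i, j}, h⟩ : GQP) ∈ H) := by
  unfold hb
  congr 1
  apply propext
  constructor
  · rintro ⟨p, hp, e⟩
    have : p = ⟨{i, j}, h⟩ := Subtype.ext e
    exact this ▸ hp
  · intro hp
    exact ⟨_, hp, rfl⟩

lemma mem_FH (A : Finset (Fin 6)) (p : GQP) :
    p ∈ FH A ↔ (p.1 ∩ A).card % 2 = A.card % 2 := by
  simp [FH]

lemma hb_FH (A : Finset (Fin 6)) (i j : Fin 6) (h : i ≠ j) :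
    hb (FH A) i j = decide ((({i, j} : Finset (Fin 6)) ∩ A).card % 2 = A.card % 2) := by
  rw [hb_eq _ _ _ (Finset.card_pair h)]
  simp [mem_FH]

lemma RH_FH (A : Finset (Fin 6)) (h : 5 ∉ A) : RH (FH A) = A := by
  unfold RH
  rw [hb_FH _ _ _ (by decide), hb_FH _ _ _ (by decide), hb_FH _ _ _ (by decide),
    hb_FH _ _ _ (by decide), hb_FH _ _ _ (by decide), hb_FH _ _ _ (by decide)]
  revert A
  decide +kernel

lemma FH_ne (A : Finset (Fin 6)) (h : 5 ∉ A) (h0 : A ≠ ∅) : FH A ≠ Finset.univ := by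
  intro e
  have e2 : FH ∅ = Finset.univ := by
    ext p; simp [mem_FH]
  apply h0
  rw [← RH_FH A h, e, ← e2, RH_FH ∅ (by simp)]

lemma FH_line (A : Finset (Fin 6)) (L : Finset GQP) (hL : GQLine L) :
    (L ∩ FH A).card = 1 ∨ (L ∩ FH A).card = 3 := by
  obtain ⟨h3, hd⟩ := hL
  obtain ⟨p, q, r, hpq, hpr, hqr, rfl⟩ := Finset.card_eq_three.mp h3
  have d1 := hd p (by simp) q (by simp) hpq
  have d2 := hd p (by simp) r (by simp) hpr
  have d3 := hd q (by simp) r (by simp) hqr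
  have hu : p.1 ∪ q.1 ∪ r.1 = Finset.univ := by
    apply Finset.eq_univ_of_card
    rw [Finset.card_union_of_disjoint (Finset.disjoint_union_left.mpr ⟨d2, d3⟩),
      Finset.card_union_of_disjoint d1, p.2, q.2, r.2]
    rfl
  have hA : A.card = (p.1 ∩ A).card + (q.1 ∩ A).card + (r.1 ∩ A).card := by
    rw [← Finset.card_union_of_disjoint, ← Finset.card_union_of_disjoint,
      ← Finset.union_inter_distrib_right, ← Finset.union_inter_distrib_right, hu,
      Finset.univ_inter]
    · rw [← Finset.union_inter_distrib_right]
      exact (Finset.disjoint_union_left.mpr ⟨d2, d3⟩).mono Finset.inter_subset_left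
        Finset.inter_subset_left
    · exact d1.mono Finset.inter_subset_left Finset.inter_subset_left
  have hc : (({p, q, r} : Finset GQP) ∩ FH A).card =
      (if p ∈ FH A then 1 else 0) + (if q ∈ FH A then 1 else 0) +
        (if r ∈ FH A then 1 else 0) := by
    rw [← Finset.filter_mem_eq_inter, Finset.card_filter, Finset.sum_insert (by simp [hpq, hpr]),
      Finset.sum_insert (by simp [hqr]), Finset.sum_singleton, add_assoc]
  rw [hc]
  simp only [mem_FH]
  split_ifs <;> omega

lemma line_bits (H : Finset GQP) (hH : GQHyp H) (a b c d e f : Fin 6)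
    (h : [a, b, c, d, e, f].Nodup) : (hb H a b ^^ hb H c d ^^ hb H e f) = true := by
  simp at h
  have h1 : a ≠ b := by tauto
  have h2 : c ≠ d := by tauto
  have h3 : e ≠ f := by tauto
  rw [hb_eq _ _ _ (Finset.card_pair h1), hb_eq _ _ _ (Finset.card_pair h2),
    hb_eq _ _ _ (Finset.card_pair h3)]
  set p : GQP := ⟨{a, b}, Finset.card_pair h1⟩ with hp
  set q : GQP := ⟨{c, d}, Finset.card_pair h2⟩ with hq
  set r : GQP := ⟨{e, f}, Finset.card_pair h3⟩ with hr
  have d1 : Disjoint p.1 q.1 := by simp [hp, hq]; grind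
  have d2 : Disjoint p.1 r.1 := by simp [hp, hr]; grind
  have d3 : Disjoint q.1 r.1 := by simp [hq, hr]; grind
  have key : ∀ s t : GQP, Disjoint s.1 t.1 → s ≠ t := by
    rintro s t hd rfl
    have := s.2
    rw [disjoint_self.mp hd] at this
    simp at this
  have hpq := key _ _ d1
  have hpr := key _ _ d2
  have hqr := key _ _ d3
  have hL : GQLine {p, q, r} := by
    refine ⟨Finset.card_eq_three.mpr ⟨p, q, r, hpq, hpr, hqr, rfl⟩, ?_⟩
    intro s hs t ht hst
    simp only [Finset.mem_insert, Finset.mem_singleton] at hs ht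
    rcases hs with rfl | rfl | rfl <;> rcases ht with rfl | rfl | rfl <;>
      first
      | exact absurd rfl hst
      | assumption
      | (apply Disjoint.symm; assumption)
  have := hH.2 _ hL
  rw [← Finset.filter_mem_eq_inter, Finset.card_filter, Finset.sum_insert (by simp [hpq, hpr]),
      Finset.sum_insert (by simp [hqr]), Finset.sum_singleton] at this
  by_cases m1 : p ∈ H <;> by_cases m2 : q ∈ H <;> by_cases m3 : r ∈ H <;>
    simp [m1, m2, m3] at this ⊢

lemma TT_spec : ∀ x y0 y1 y2 y3 y4 : Bool, (y0 ^^ y1 ^^ y2 ^^ y3 ^^ y4) = true →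
    ∀ i j : Fin 6, i < j →
    decide ((({i, j} : Finset (Fin 6)) ∩ TT x y0 y1 y2 y3 y4).card % 2 =
      (TT x y0 y1 y2 y3 y4).card % 2) =
    if j = 5 then ![y0, y1, y2, y3, y4, false] i else
      (![y0, y1, y2, y3, y4, false] i ^^ ![y0, y1, y2, y3, y4, false] j ^^ x ^^ y0 ^^ y1) := by
  decide +kernel

lemma hb_ext (H K : Finset GQP) (h : ∀ i j : Fin 6, i < j → hb H i j = hb K i j) : H = K := by
  ext ⟨s, hs⟩
  obtain ⟨i, j, hij, rfl⟩ := Finset.card_eq_two.mp hs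
  rcases lt_or_gt_of_ne hij with hl | hl
  · have := h i j hl
    rw [hb_eq _ _ _ hs, hb_eq _ _ _ hs] at this
    simpa using this
  · have := h j i hl
    have hs' := hs
    rw [Finset.pair_comm] at hs'
    rw [hb_eq _ _ _ hs', hb_eq _ _ _ hs'] at this
    simp only [Finset.pair_comm j i] at this
    simpa using this

lemma FH_RH (H : Finset GQP) (hH : GQHyp H) : FH (RH H) = H := by
  have l1 := line_bits H hH 0 1 2 3 4 5 (by decide)
  have l2 := line_bits H hH 0 1 2 4 3 5 (by decide)
  have l3 := line_bits H hH 0 1 3 4 2 5 (by decide)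
  have l4 := line_bits H hH 0 2 1 3 4 5 (by decide)
  have l5 := line_bits H hH 0 2 1 4 3 5 (by decide)
  have l6 := line_bits H hH 0 2 3 4 1 5 (by decide)
  have l7 := line_bits H hH 0 3 1 2 4 5 (by decide)
  have l8 := line_bits H hH 0 3 1 4 2 5 (by decide)
  have l9 := line_bits H hH 0 3 2 4 1 5 (by decide)
  have l10 := line_bits H hH 0 4 1 2 3 5 (by decide)
  have l11 := line_bits H hH 0 4 1 3 2 5 (by decide)
  have l12 := line_bits H hH 0 4 2 3 1 5 (by decide)
  have l13 := line_bits H hH 1 2 3 4 0 5 (by decide)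
  have l14 := line_bits H hH 1 3 2 4 0 5 (by decide)
  have l15 := line_bits H hH 1 4 2 3 0 5 (by decide)
  apply hb_ext
  intro i j hij
  rw [hb_FH _ _ _ hij.ne]
  unfold RH
  have hs : (hb H 0 5 ^^ hb H 1 5 ^^ hb H 2 5 ^^ hb H 3 5 ^^ hb H 4 5) = true := by
    clear hij
    generalize hb H 0 1 = x01 at *
    generalize hb H 0 2 = x02 at *
    generalize hb H 0 3 = x03 at *
    generalize hb H 0 4 = x04 at *
    generalize hb H 1 2 = x12 at *
    generalize hb H 1 3 = x13 at *
    generalize hb H 1 4 = x14 at *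
    generalize hb H 2 3 = x23 at *
    generalize hb H 2 4 = x24 at *
    generalize hb H 3 4 = x34 at *
    generalize hb H 0 5 = x05 at *
    generalize hb H 1 5 = x15 at *
    generalize hb H 2 5 = x25 at *
    generalize hb H 3 5 = x35 at *
    generalize hb H 4 5 = x45 at *
    clear i j hH
    clear l2 l4 l5 l6 l7 l8 l9 l11 l14 l15
    cases x01 <;> cases x12 <;> cases x23 <;> cases x34 <;> cases x04 <;> simp_all
  rw [TT_spec _ _ _ _ _ _ hs _ _ hij]
  fin_cases i <;> fin_cases j <;> first | (exfalso; revert hij; decide) | skip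
  all_goals
    simp [-Bool.bne_assoc]
    try grind

/-- GQ(2,2) has exactly `2^5 - 1 = 31` geometric hyperplanes. -/
theorem card_GQHyp : Nat.card {H : Finset GQP // GQHyp H} = 2 ^ 5 - 1 ∧
    (2 ^ 5 - 1 : ℕ) = 31 := by
  refine ⟨?_, by norm_num⟩
  have h5 : ∀ H, 5 ∉ RH H := by
    intro H
    simp [RH, TT]
  let e : {A : Finset (Fin 6) // 5 ∉ A ∧ A ≠ ∅} ≃ {H : Finset GQP // GQHyp H} :=
    { toFun := fun A => ⟨FH A.1, FH_ne _ A.2.1 A.2.2, FH_line _⟩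
      invFun := fun H => ⟨RH H.1, h5 _, by
        intro h0
        apply H.2.1
        rw [← FH_RH _ H.2, h0]
        ext p
        simp [mem_FH]⟩
      left_inv := fun A => Subtype.ext (RH_FH _ A.2.1)
      right_inv := fun H => Subtype.ext (FH_RH _ H.2) }
  rw [← Nat.card_congr e, Nat.card_eq_fintype_card]
  decide +kernel
end

section
/- Among the geometric hyperplanes of GQ(2,2), exactly 6 have cardinality 5 (the ovoids), exactly 15 have cardinality 7 (the perp-sets), and exactly 10 have cardinality 9 (the grids); moreover every geometric hyperplane of GQ(2,2) has cardinality 5, 7 or 9. -/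
/-- The set of points `p` with `|p ∩ S| ≡ |S| (mod 2)`. -/
def GQg (S : Finset (Fin 6)) : Finset GQP :=
  Finset.univ.filter (fun p => (p.1 ∩ S).card % 2 = S.card % 2)

/-- The point `{i, j}`. -/
def GQpt (i j : Fin 6) (h : ({i, j} : Finset (Fin 6)).card = 2 := by decide) : GQP := ⟨{i, j}, h⟩

theorem GQ_line_three (H : Finset GQP) (hH : GQHyp H) (a b c : GQP) (hab : Disjoint a.1 b.1)
    (hac : Disjoint a.1 c.1) (hbc : Disjoint b.1 c.1) : (c ∈ H ↔ (a ∈ H ↔ b ∈ H)) := by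
  have ne : ∀ x y : GQP, Disjoint x.1 y.1 → x ≠ y := by
    rintro x y h rfl
    have h1 := x.2
    rw [disjoint_self] at h
    rw [h] at h1
    simp at h1
  have n1 := ne _ _ hab
  have n2 := ne _ _ hac
  have n3 := ne _ _ hbc
  have hL : GQLine {a, b, c} := by
    refine ⟨Finset.card_eq_three.2 ⟨a, b, c, n1, n2, n3, rfl⟩, ?_⟩
    intro p hp q hq hpq
    simp only [Finset.mem_insert, Finset.mem_singleton] at hp hq
    rcases hp with rfl | rfl | rfl <;> rcases hq with rfl | rfl | rfl <;>
      first
      | exact absurd rfl hpq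
      | assumption
      | (apply Disjoint.symm; assumption)
  have h := hH.2 _ hL
  by_cases ha : a ∈ H <;> by_cases hb : b ∈ H <;> by_cases hc : c ∈ H <;>
    simp [Finset.insert_inter_of_mem, Finset.insert_inter_of_notMem,
      Finset.singleton_inter_of_mem, Finset.singleton_inter_of_notMem,
      ha, hb, hc, n1, n2, n3] at h ⊢

theorem GQ_step (H K : Finset GQP) (hH : GQHyp H) (hK : GQHyp K) (a b c : GQP)
    (ha : a ∈ H ↔ a ∈ K) (hb : b ∈ H ↔ b ∈ K)
    (h : Disjoint a.1 b.1 ∧ Disjoint a.1 c.1 ∧ Disjoint b.1 c.1) : (c ∈ H ↔ c ∈ K) := by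
  rw [GQ_line_three H hH a b c h.1 h.2.1 h.2.2, GQ_line_three K hK a b c h.1 h.2.1 h.2.2, ha, hb]

theorem GQ_points : ∀ p : GQP, p ∈ [GQpt 0 1, GQpt 0 2, GQpt 0 3, GQpt 0 4, GQpt 0 5,
    GQpt 1 2, GQpt 1 3, GQpt 1 4, GQpt 1 5, GQpt 2 3, GQpt 2 4, GQpt 2 5, GQpt 3 4, GQpt 3 5,
    GQpt 4 5] := by
  decide +kernel

theorem GQ_unique (H K : Finset GQP) (hH : GQHyp H) (hK : GQHyp K)
    (h01 : GQpt 0 1 ∈ H ↔ GQpt 0 1 ∈ K) (h02 : GQpt 0 2 ∈ H ↔ GQpt 0 2 ∈ K)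
    (h03 : GQpt 0 3 ∈ H ↔ GQpt 0 3 ∈ K) (h04 : GQpt 0 4 ∈ H ↔ GQpt 0 4 ∈ K)
    (h12 : GQpt 1 2 ∈ H ↔ GQpt 1 2 ∈ K) : H = K := by
  have st := GQ_step H K hH hK
  have h45 := st _ _ (GQpt 4 5) h12 h03 (by decide)
  have h35 := st _ _ (GQpt 3 5) h12 h04 (by decide)
  have h24 := st _ _ (GQpt 2 4) h35 h01 (by decide)
  have h14 := st _ _ (GQpt 1 4) h35 h02 (by decide)
  have h23 := st _ _ (GQpt 2 3) h45 h01 (by decide)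
  have h13 := st _ _ (GQpt 1 3) h45 h02 (by decide)
  have h05 := st _ _ (GQpt 0 5) h24 h13 (by decide)
  have h15 := st _ _ (GQpt 1 5) h03 h24 (by decide)
  have h25 := st _ _ (GQpt 2 5) h03 h14 (by decide)
  have h34 := st _ _ (GQpt 3 4) h12 h05 (by decide)
  ext p
  have hp := GQ_points p
  simp only [List.mem_cons, List.not_mem_nil, or_false] at hp
  rcases hp with rfl | rfl | rfl | rfl | rfl | rfl | rfl | rfl | rfl | rfl | rfl | rfl | rfl |
    rfl | rfl <;> assumption

theorem GQg_line (S : Finset (Fin 6)) (L : Finset GQP) (hL : GQLine L) :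
    (L ∩ GQg S).card = 1 ∨ (L ∩ GQg S).card = 3 := by
  obtain ⟨h3, hd⟩ := hL
  obtain ⟨a, b, c, n1, n2, n3, rfl⟩ := Finset.card_eq_three.1 h3
  have hab := hd a (by simp) b (by simp) n1
  have hac := hd a (by simp) c (by simp) n2
  have hbc := hd b (by simp) c (by simp) n3
  have habc : Disjoint (a.1 ∪ b.1) c.1 := Finset.disjoint_union_left.2 ⟨hac, hbc⟩
  have hu : a.1 ∪ b.1 ∪ c.1 = Finset.univ := by
    apply Finset.eq_univ_of_card
    rw [Finset.card_union_of_disjoint habc, Finset.card_union_of_disjoint hab, a.2, b.2, c.2]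
    rfl
  have hs : S.card = (a.1 ∩ S).card + (b.1 ∩ S).card + (c.1 ∩ S).card := by
    rw [← Finset.card_union_of_disjoint, ← Finset.card_union_of_disjoint,
      ← Finset.union_inter_distrib_right, ← Finset.union_inter_distrib_right, hu,
      Finset.univ_inter]
    · rw [← Finset.union_inter_distrib_right]
      exact habc.mono Finset.inter_subset_left Finset.inter_subset_left
    · exact hab.mono Finset.inter_subset_left Finset.inter_subset_left
  have mem : ∀ p : GQP, p ∈ GQg S ↔ (p.1 ∩ S).card % 2 = S.card % 2 := by
    intro p; simp [GQg]
  by_cases ha : a ∈ GQg S <;> by_cases hb : b ∈ GQg S <;> by_cases hc : c ∈ GQg S <;>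
    simp [Finset.insert_inter_of_mem, Finset.insert_inter_of_notMem,
      Finset.singleton_inter_of_mem, Finset.singleton_inter_of_notMem,
      ha, hb, hc, n1, n2, n3] <;>
    (rw [mem] at ha hb hc; omega)

/-- The index sets: nonempty subsets of `{1, …, 5}`. -/
def GQU : Finset (Finset (Fin 6)) := ({1, 2, 3, 4, 5} : Finset (Fin 6)).powerset

theorem GQg_ne : ∀ S ∈ GQU, S ≠ ∅ → GQg S ≠ Finset.univ := by
  decide +kernel

theorem GQg_exists : ∀ b1 b2 b3 b4 b5 : Bool, (∃ S ∈ GQU.erase ∅,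
    decide (GQpt 0 1 ∈ GQg S) = b1 ∧ decide (GQpt 0 2 ∈ GQg S) = b2 ∧
    decide (GQpt 0 3 ∈ GQg S) = b3 ∧ decide (GQpt 0 4 ∈ GQg S) = b4 ∧
    decide (GQpt 1 2 ∈ GQg S) = b5) ∨ (b1 && b2 && b3 && b4 && b5) = true := by
  decide +kernel

theorem GQg_hyp (S : Finset (Fin 6)) (hS : S ∈ GQU.erase ∅) : GQHyp (GQg S) :=
  ⟨GQg_ne S (Finset.mem_of_mem_erase hS) (Finset.ne_of_mem_erase hS), GQg_line S⟩

theorem GQ_not_all (H : Finset GQP) (hH : GQHyp H)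
    (h01 : GQpt 0 1 ∈ H) (h02 : GQpt 0 2 ∈ H) (h03 : GQpt 0 3 ∈ H) (h04 : GQpt 0 4 ∈ H)
    (h12 : GQpt 1 2 ∈ H) : False := by
  have st : ∀ a b c : GQP, a ∈ H → b ∈ H →
      (Disjoint a.1 b.1 ∧ Disjoint a.1 c.1 ∧ Disjoint b.1 c.1) → c ∈ H := fun a b c ha hb h =>
    (GQ_line_three H hH a b c h.1 h.2.1 h.2.2).2 (by simp [ha, hb])
  have h45 := st _ _ (GQpt 4 5) h12 h03 (by decide)
  have h35 := st _ _ (GQpt 3 5) h12 h04 (by decide)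
  have h24 := st _ _ (GQpt 2 4) h35 h01 (by decide)
  have h14 := st _ _ (GQpt 1 4) h35 h02 (by decide)
  have h23 := st _ _ (GQpt 2 3) h45 h01 (by decide)
  have h13 := st _ _ (GQpt 1 3) h45 h02 (by decide)
  have h05 := st _ _ (GQpt 0 5) h24 h13 (by decide)
  have h15 := st _ _ (GQpt 1 5) h03 h24 (by decide)
  have h25 := st _ _ (GQpt 2 5) h03 h14 (by decide)
  have h34 := st _ _ (GQpt 3 4) h12 h05 (by decide)
  apply hH.1
  rw [Finset.eq_univ_iff_forall]
  intro p
  have hp := GQ_points p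
  simp only [List.mem_cons, List.not_mem_nil, or_false] at hp
  rcases hp with rfl | rfl | rfl | rfl | rfl | rfl | rfl | rfl | rfl | rfl | rfl | rfl | rfl |
    rfl | rfl <;> assumption

theorem GQHyp_iff (H : Finset GQP) : GQHyp H ↔ H ∈ (GQU.erase ∅).image GQg := by
  rw [Finset.mem_image]
  constructor
  · intro hH
    rcases GQg_exists (decide (GQpt 0 1 ∈ H)) (decide (GQpt 0 2 ∈ H)) (decide (GQpt 0 3 ∈ H))
      (decide (GQpt 0 4 ∈ H)) (decide (GQpt 1 2 ∈ H)) with ⟨S, hS, h1, h2, h3, h4, h5⟩ | h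
    · rw [decide_eq_decide] at h1 h2 h3 h4 h5
      exact ⟨S, hS, GQ_unique _ _ (GQg_hyp S hS) hH h1 h2 h3 h4 h5⟩
    · simp only [Bool.and_eq_true, decide_eq_true_eq] at h
      obtain ⟨⟨⟨⟨h1, h2⟩, h3⟩, h4⟩, h5⟩ := h
      exact (GQ_not_all H hH h1 h2 h3 h4 h5).elim
  · rintro ⟨S, hS, rfl⟩
    exact GQg_hyp S hS

theorem GQ_card (k : ℕ) : Nat.card {H : Finset GQP // GQHyp H ∧ H.card = k} =
    (((GQU.erase ∅).image GQg).filter (fun H => H.card = k)).card := by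
  apply Nat.subtype_card
  intro H
  rw [Finset.mem_filter, GQHyp_iff]

theorem GQg_cards : ∀ S ∈ GQU.erase ∅,
    (GQg S).card = 5 ∨ (GQg S).card = 7 ∨ (GQg S).card = 9 := by
  decide +kernel

/-- GQ(2,2) has exactly 6 ovoids (hyperplanes of cardinality 5), 15 perp-sets
(cardinality 7) and 10 grids (cardinality 9), and every geometric hyperplane has
cardinality 5, 7 or 9. -/
theorem GQHyp_classification :
    Nat.card {H : Finset GQP // GQHyp H ∧ H.card = 5} = 6 ∧
    Nat.card {H : Finset GQP // GQHyp H ∧ H.card = 7} = 15 ∧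
    Nat.card {H : Finset GQP // GQHyp H ∧ H.card = 9} = 10 ∧
    ∀ H : Finset GQP, GQHyp H → H.card = 5 ∨ H.card = 7 ∨ H.card = 9 := by
  refine ⟨?_, ?_, ?_, ?_⟩
  · rw [GQ_card]; decide +kernel
  · rw [GQ_card]; decide +kernel
  · rw [GQ_card]; decide +kernel
  · intro H hH
    rw [GQHyp_iff, Finset.mem_image] at hH
    obtain ⟨S, hS, rfl⟩ := hH
    exact GQg_cards S hS
end

section
/- Let P be the set of points of GQ(2,2), for i ∈ Fin 6 let e_i ⊆ P be the set of 2-element subsets of Fin 6 containing i, and let f_i = 1 + χ_{e_i} : P → ZMod 2, where χ_{e_i} is the indicator function of e_i. Then f_0 + f_1 + f_2 + f_3 + f_4 + f_5 = 0 (equivalently, every point of GQ(2,2) lies in exactly two of the six ovoids e_i), and the five functions f_0, f_1, f_2, f_3, f_4 are linearly independent over ZMod 2. -/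
/-- `ovoidE i` is the ovoid of GQ(2,2) consisting of all 2-element subsets of `Fin 6`
containing `i`. -/
def ovoidE (i : Fin 6) : Finset GQP := Finset.univ.filter (fun p : GQP => i ∈ p.1)

/-- `fE i = 1 + χ_{e_i}`, where `χ_{e_i}` is the indicator function of the ovoid `e_i`. -/
def fE (i : Fin 6) : GQP → ZMod 2 :=
  fun p => 1 + (if p ∈ ovoidE i then 1 else 0)

theorem fE_apply (i : Fin 6) (p : GQP) : fE i p = 1 + (if i ∈ p.1 then 1 else 0) := by
  simp [fE, ovoidE]

/-- The six functions `1 + χ_{e_i}` sum to zero (equivalently, every point of GQ(2,2)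
lies in exactly two of the six ovoids), and the first five of them are linearly
independent over `F₂`. -/
theorem ovoid_relation_and_independence :
    fE 0 + fE 1 + fE 2 + fE 3 + fE 4 + fE 5 = 0 ∧
    LinearIndependent (ZMod 2) (fun i : Fin 5 => fE i.castSucc) := by
  constructor
  · funext p
    simp only [Pi.add_apply, Pi.zero_apply, fE_apply]
    obtain ⟨s, hs⟩ := p
    revert s
    decide
  · rw [Fintype.linearIndependent_iff]
    intro g hg
    have key : ∀ p : GQP, ∑ j : Fin 5, g j * (1 + (if j.castSucc ∈ p.1 then 1 else 0)) = 0 := by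
      intro p
      have h := congrFun hg p
      simpa only [Finset.sum_apply, Pi.smul_apply, smul_eq_mul, Pi.zero_apply, fE_apply] using h
    have h0 := key ⟨{0, 5}, by decide⟩
    have h1 := key ⟨{1, 5}, by decide⟩
    have h2 := key ⟨{2, 5}, by decide⟩
    have h3 := key ⟨{3, 5}, by decide⟩
    have h4 := key ⟨{4, 5}, by decide⟩
    have h5 := key ⟨{0, 1}, by decide⟩
    clear key hg
    rw [Fin.sum_univ_five] at h0 h1 h2 h3 h4 h5
    suffices h : g 0 = 0 ∧ g 1 = 0 ∧ g 2 = 0 ∧ g 3 = 0 ∧ g 4 = 0 by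
      obtain ⟨a, b, c, d, e⟩ := h
      intro i
      fin_cases i <;> assumption
    generalize g 0 = a at *
    generalize g 1 = b at *
    generalize g 2 = c at *
    generalize g 3 = d at *
    generalize g 4 = e at *
    clear g
    revert a b c d e
    decide
end

section
/- Let P be the set of 2-element subsets of Fin 6 and let Aut be the group of bijections σ : P → P such that for all p, q ∈ P, σ(p) and σ(q) are disjoint if and only if p and q are disjoint. Then the natural group homomorphism from Perm (Fin 6) to Aut, sending a permutation of Fin 6 to its induced action on 2-element subsets, is an isomorphism; in particular the full automorphism group of GQ(2,2) is isomorphic to S6 and has order 720. -/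
/-- The action of a permutation of `Fin 6` on the 2-element subsets of `Fin 6`. -/
def inducedPerm (τ : Equiv.Perm (Fin 6)) : Equiv.Perm GQP where
  toFun p := ⟨p.1.image τ, by rw [Finset.card_image_of_injective _ τ.injective, p.2]⟩
  invFun p := ⟨p.1.image τ.symm, by rw [Finset.card_image_of_injective _ τ.symm.injective, p.2]⟩
  left_inv p := by
    ext x
    simp [Finset.mem_image]
  right_inv p := by
    ext x
    simp [Finset.mem_image]

/-- The natural homomorphism `Perm (Fin 6) →* Perm GQP`, sending a permutation of `Fin 6`
to its induced action on 2-element subsets. -/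
def inducedHom : Equiv.Perm (Fin 6) →* Equiv.Perm GQP where
  toFun := inducedPerm
  map_one' := by
    ext p x
    simp [inducedPerm]
  map_mul' σ τ := by
    ext p x
    simp [inducedPerm, Finset.mem_image]

/-- The automorphism group of GQ(2,2): the group of bijections of the point set that
preserve disjointness (i.e. collinearity) in both directions. -/
def GQAut : Subgroup (Equiv.Perm GQP) where
  carrier := {σ | ∀ p q : GQP, (Disjoint (σ p).1 (σ q).1 ↔ Disjoint p.1 q.1)}
  one_mem' := by intro p q; simp
  mul_mem' := by
    intro σ τ hσ hτ p q
    simpa using (hσ (τ p) (τ q)).trans (hτ p q)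
  inv_mem' := by
    intro σ hσ p q
    simpa using (hσ (σ⁻¹ p) (σ⁻¹ q)).symm

lemma inducedHom_mem_GQAut (τ : Equiv.Perm (Fin 6)) : inducedHom τ ∈ GQAut := by
  intro p q
  exact Finset.disjoint_image τ.injective

/-- Four distinct pairwise intersecting 2-sets have a common point: whatever lies in the
first two lies in the third. -/
lemma four_pairs (A B C D : Finset (Fin 6)) (hA : A.card = 2) (hB : B.card = 2)
    (hC : C.card = 2) (hD : D.card = 2) (hAB : A ≠ B) (hAC : A ≠ C) (hAD : A ≠ D)
    (hBC : B ≠ C) (hBD : B ≠ D) (hCD : C ≠ D)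
    (iAC : ¬ Disjoint A C) (iAD : ¬ Disjoint A D)
    (iBC : ¬ Disjoint B C) (iBD : ¬ Disjoint B D) (iCD : ¬ Disjoint C D)
    (k : Fin 6) (kA : k ∈ A) (kB : k ∈ B) : k ∈ C := by
  have key : ∀ X : Finset (Fin 6), X.card = 2 → k ∈ X → ∃ y, y ≠ k ∧ X = {k, y} := by
    intro X hX hk
    obtain ⟨x, y, hxy, rfl⟩ := Finset.card_eq_two.1 hX
    simp only [Finset.mem_insert, Finset.mem_singleton] at hk
    rcases hk with rfl | rfl
    · exact ⟨y, hxy.symm, rfl⟩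
    · exact ⟨x, hxy, Finset.pair_comm _ _⟩
  have key2 : ∀ x y : Fin 6, x ≠ y → ∀ X : Finset (Fin 6), X.card = 2 → k ∉ X →
      ¬ Disjoint {k, x} X → ¬ Disjoint {k, y} X → X = {x, y} := by
    intro x y hxy X hX hk h1 h2
    have hx : x ∈ X := by
      by_contra h
      exact h1 (by simp [Finset.disjoint_insert_left, hk, h])
    have hy : y ∈ X := by
      by_contra h
      exact h2 (by simp [Finset.disjoint_insert_left, hk, h])
    symm
    apply Finset.eq_of_subset_of_card_le
    · intro z hz
      simp only [Finset.mem_insert, Finset.mem_singleton] at hz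
      rcases hz with rfl | rfl <;> assumption
    · rw [hX, Finset.card_pair hxy]
  obtain ⟨a, ha, rfl⟩ := key A hA kA
  obtain ⟨b, hb, rfl⟩ := key B hB kB
  have hab : a ≠ b := fun h => hAB (by rw [h])
  by_contra hk
  have hC' := key2 a b hab C hC hk iAC iBC
  by_cases hkD : k ∈ D
  · obtain ⟨d, hd, rfl⟩ := key D hD hkD
    subst hC'
    apply iCD
    have h1 : a ≠ d := fun h => hAD (by rw [h])
    have h2 : b ≠ d := fun h => hBD (by rw [h])
    simp [ha.symm, hb.symm, h1.symm, h2.symm]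
  · exact hCD (hC'.trans (key2 a b hab D hD hkD iAD iBD).symm)

/-- The point `{i, j}`. -/
def mkPair (i j : Fin 6) (h : i ≠ j) : GQP := ⟨{i, j}, Finset.card_pair h⟩

lemma mkPair_inj (i j k : Fin 6) (hj : i ≠ j) (hk : i ≠ k) (h : j ≠ k) :
    mkPair i j hj ≠ mkPair i k hk := by
  intro e
  have : j ∈ (mkPair i k hk).1 := by rw [← e]; simp [mkPair]
  simp only [mkPair, Finset.mem_insert, Finset.mem_singleton] at this
  rcases this with h' | h'
  · exact hj h'.symm
  · exact h h'

lemma exists_pair (i : Fin 6) (p : GQP) (hi : i ∈ p.1) : ∃ j, ∃ h : i ≠ j, p = mkPair i j h := by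
  obtain ⟨s, hs⟩ := p
  obtain ⟨x, y, hxy, rfl⟩ := Finset.card_eq_two.1 hs
  simp only [Finset.mem_insert, Finset.mem_singleton] at hi
  rcases hi with rfl | rfl
  · exact ⟨y, hxy, rfl⟩
  · exact ⟨x, hxy.symm, Subtype.ext (Finset.pair_comm _ _)⟩

lemma exists_center (σ : Equiv.Perm GQP) (hσ : σ ∈ GQAut) (i : Fin 6) :
    ∃ k, ∀ p : GQP, i ∈ p.1 → k ∈ (σ p).1 := by
  have hint : ∀ p q : GQP, i ∈ p.1 → i ∈ q.1 → ¬ Disjoint (σ p).1 (σ q).1 := by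
    intro p q hp hq h
    exact Finset.disjoint_left.1 ((hσ p q).1 h) hp hq
  have hne : ∀ p q : GQP, p ≠ q → (σ p).1 ≠ (σ q).1 := fun p q h e =>
    h (σ.injective (Subtype.ext e))
  have hm : ∀ j h, i ∈ (mkPair i j h).1 := fun j h => by simp [mkPair]
  obtain ⟨a, b, ha, hb, hab⟩ : ∃ a b : Fin 6, i ≠ a ∧ i ≠ b ∧ a ≠ b := by
    clear * -
    revert i; decide
  obtain ⟨k, kA, kB⟩ := Finset.not_disjoint_iff.1 (hint _ _ (hm a ha) (hm b hb))
  refine ⟨k, fun p hp => ?_⟩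
  obtain ⟨c, hc, rfl⟩ := exists_pair i p hp
  by_cases hca : a = c
  · subst hca; exact kA
  by_cases hcb : b = c
  · subst hcb; exact kB
  obtain ⟨d, hd, had, hbd, hcd⟩ : ∃ d : Fin 6, i ≠ d ∧ a ≠ d ∧ b ≠ d ∧ c ≠ d := by
    clear * -
    revert i a b c; decide
  exact four_pairs (σ (mkPair i a ha)).1 (σ (mkPair i b hb)).1 _ (σ (mkPair i d hd)).1
    (σ _).2 (σ _).2 (σ _).2 (σ _).2
    (hne _ _ (mkPair_inj _ _ _ _ _ hab)) (hne _ _ (mkPair_inj _ _ _ _ _ hca))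
    (hne _ _ (mkPair_inj _ _ _ _ _ had)) (hne _ _ (mkPair_inj _ _ _ _ _ hcb))
    (hne _ _ (mkPair_inj _ _ _ _ _ hbd)) (hne _ _ (mkPair_inj _ _ _ _ _ hcd))
    (hint _ _ (hm _ _) (hm _ _)) (hint _ _ (hm _ _) (hm _ _)) (hint _ _ (hm _ _) (hm _ _))
    (hint _ _ (hm _ _) (hm _ _)) (hint _ _ (hm _ _) (hm _ _)) k kA kB

lemma induced_surj (σ : Equiv.Perm GQP) (hσ : σ ∈ GQAut) : ∃ τ, inducedHom τ = σ := by
  choose t ht using exists_center σ hσ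
  have tinj : Function.Injective t := by
    intro i j hij
    by_contra hne
    obtain ⟨a, b, hia, hjb, hja, hib, hab⟩ :
        ∃ a b : Fin 6, i ≠ a ∧ j ≠ b ∧ j ≠ a ∧ i ≠ b ∧ a ≠ b := by
      clear * -
      revert i j; decide
    have hd : Disjoint (mkPair i a hia).1 (mkPair j b hjb).1 := by
      simp only [mkPair, Finset.disjoint_insert_left, Finset.disjoint_singleton_left,
        Finset.mem_insert, Finset.mem_singleton, not_or]
      exact ⟨⟨hne, hib⟩, hja.symm, hab⟩
    have h1 := ht i (mkPair i a hia) (by simp [mkPair])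
    have h2 := ht j (mkPair j b hjb) (by simp [mkPair])
    exact Finset.disjoint_left.1 ((hσ _ _).2 hd) h1 (hij ▸ h2)
  refine ⟨Equiv.ofBijective t (Finite.injective_iff_bijective.1 tinj), Equiv.ext fun p => ?_⟩
  apply Subtype.ext
  apply Finset.eq_of_subset_of_card_le
  · intro z hz
    obtain ⟨x, hx, rfl⟩ := Finset.mem_image.1 hz
    exact ht x p hx
  · rw [(σ p).2, (inducedHom _ p).2]

lemma induced_inj : Function.Injective inducedHom := by
  rw [injective_iff_map_eq_one]
  intro τ h
  ext1 i
  obtain ⟨a, b, ha, hb, hab⟩ : ∃ a b : Fin 6, i ≠ a ∧ i ≠ b ∧ a ≠ b := by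
    clear * -
    revert i; decide
  have hm : ∀ j (hj : i ≠ j), τ i = i ∨ τ i = j := by
    intro j hj
    have h1 : τ i ∈ (inducedHom τ (mkPair i j hj)).1 :=
      Finset.mem_image.2 ⟨i, by simp [mkPair], rfl⟩
    rw [h] at h1
    simpa [mkPair] using h1
  rcases hm a ha with h1 | h1
  · exact h1
  rcases hm b hb with h2 | h2
  · exact h2
  exact absurd (h1.symm.trans h2) hab

/-- The natural group homomorphism `Perm (Fin 6) → Aut(GQ(2,2))` is an isomorphism;
in particular the full automorphism group of GQ(2,2) is isomorphic to `S₆` and has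
order 720. -/
theorem GQAut_eq_S6 :
    Function.Bijective (inducedHom.codRestrict GQAut inducedHom_mem_GQAut) ∧
    Nat.card GQAut = 720 := by
  have hb : Function.Bijective (inducedHom.codRestrict GQAut inducedHom_mem_GQAut) := by
    constructor
    · intro x y h
      exact induced_inj (congrArg Subtype.val h)
    · rintro ⟨σ, hσ⟩
      obtain ⟨τ, rfl⟩ := induced_surj σ hσ
      exact ⟨τ, rfl⟩
  refine ⟨hb, ?_⟩
  rw [← Nat.card_eq_of_bijective _ hb, Nat.card_eq_fintype_card, Fintype.card_perm,
    Fintype.card_fin]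
  rfl
end
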